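/- arXiv:1802.05724 — 3 statements merged into one kernel-verified Lean document; each statement's English description precedes it below -/
import Mathlib

section
/- Let p>1, Q>1, and let q₀ = 1 - s⁻_p(Q). Then on the real line with Lebesgue measure the range q > q₀ in the inclusion RH_p ⊂ A_q is sharp: there exists a weight w on ℝ with [w]_{RH_p} = Q and [w]_{q₀} = ∞, i.e. w ∉ A_{q₀}. -/
open MeasureTheory Set Filter

noncomputable section

/-- Average of `f` over the interval `(a,b)` with respect to Lebesgue measure. -/
def intAvg (a b : ℝ) (f : ℝ → ℝ) : ℝ := ⨍ x in Ioo a b, f x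

/-- The `A_p` characteristic quantity `⟨w⟩_I ⟨w^{-1/(p-1)}⟩_I^{p-1}` of `w` on `I = (a,b)`. -/
def ApChar (w : ℝ → ℝ) (p a b : ℝ) : ℝ :=
  intAvg a b w * (intAvg a b fun x => w x ^ (-1 / (p - 1))) ^ (p - 1)

/-- The `RH_p` characteristic quantity `⟨w^p⟩_I^{1/p} ⟨w⟩_I^{-1}` of `w` on `I = (a,b)`. -/
def RHChar (w : ℝ → ℝ) (p a b : ℝ) : ℝ :=
  (intAvg a b fun x => w x ^ p) ^ (1 / p) * (intAvg a b w)⁻¹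

/-- `[w]_p ≤ C` on the real line (with the requisite integrability on every interval). -/
def MemAp (w : ℝ → ℝ) (p C : ℝ) : Prop :=
  ∀ a b : ℝ, a < b →
    IntegrableOn w (Ioo a b) ∧ IntegrableOn (fun x => w x ^ (-1 / (p - 1))) (Ioo a b) ∧
    ApChar w p a b ≤ C

/-- `[w]_{RH_p} ≤ C` on the real line (with the requisite integrability on every interval). -/
def MemRH (w : ℝ → ℝ) (p C : ℝ) : Prop :=
  ∀ a b : ℝ, a < b →
    IntegrableOn w (Ioo a b) ∧ IntegrableOn (fun x => w x ^ p) (Ioo a b) ∧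
    RHChar w p a b ≤ C

/-- The exponents `1`, `p`, `e` of the three averages of a weight that are tracked. -/
def momentExp (p e : ℝ) : Fin 3 → ℝ := ![1, p, e]

/-- `⟨w^p⟩ ≤ K ⟨w⟩^p` on the interval with endpoints `s`, `t`. -/
def RevHolderOn (p K : ℝ) (w : ℝ → ℝ) (s t : ℝ) : Prop :=
  (∫ r in s..t, w r ^ p) / (t - s) ≤ K * ((∫ r in s..t, w r) / (t - s)) ^ p

/-- `w` satisfies the reverse Hölder inequality on all subintervals of `[u,v]`, and its moments
over subintervals of `[u,v]` sharing an endpoint with `[u,v]` deviate from `X` by at most `η`. -/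
structure IsPiece (p e K η u v : ℝ) (X : Fin 3 → ℝ) (w : ℝ → ℝ) : Prop where
  dev : ∀ j, ∀ s ∈ Icc u v,
    |∫ t in u..s, (w t ^ momentExp p e j - X j)| ≤ η * min (s - u) (v - s)
  rh : ∀ s t, u ≤ s → s < t → t ≤ v → RevHolderOn p K w s t

/-- `X` occurs, with arbitrarily small loss in the reverse Hölder constant `K`, as the vector of
moments of weights on arbitrary intervals. -/
def Realizable (p e C K : ℝ) (X : Fin 3 → ℝ) : Prop :=
  ∃ c > 0, ∀ K' > K, ∀ η > 0, ∀ u v : ℝ, u < v → ∃ w : ℝ → ℝ, Measurable w ∧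
    (∀ t, c ≤ w t ∧ w t ≤ C) ∧ IsPiece p e K' η u v X w

lemma rpow_le_add_of_mem_Icc {c C x : ℝ} (hc : 0 < c) (h1 : c ≤ x) (h2 : x ≤ C) (r : ℝ) :
    x ^ r ≤ c ^ r + C ^ r := by
  have hC : 0 < C := by linarith
  rcases le_total 0 r with hr | hr
  · have := Real.rpow_le_rpow (by linarith) h2 hr
    have := Real.rpow_nonneg hc.le r
    linarith
  · have := Real.rpow_le_rpow_of_nonpos hc h1 hr
    have := Real.rpow_nonneg hC.le r
    linarith

lemma intervalIntegrable_of_bound {f : ℝ → ℝ} (hf : Measurable f) {M : ℝ}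
    (hM : ∀ t, |f t| ≤ M) (a b : ℝ) : IntervalIntegrable f volume a b := by
  refine (intervalIntegrable_const (c := M)).mono_fun hf.aestronglyMeasurable ?_
  filter_upwards with t
  have := hM t
  simp only [Real.norm_eq_abs]
  exact this.trans (le_abs_self M)

/-- Perturbation of the inequality `y ≤ K x ^ p` along a segment. -/
lemma exists_perturbation {p K K' A0 A1 B0 B1 : ℝ} (hp : 1 < p) (hK : 0 < K) (hKK : K < K')
    (hA : 0 < A0) (hB : 0 < B0)
    (hseg : ∀ c ∈ Icc (0 : ℝ) 1, c * A1 + (1 - c) * B1 ≤ K * (c * A0 + (1 - c) * B0) ^ p) :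
    ∃ δ > 0, ∀ c ∈ Icc (0 : ℝ) 1, ∀ x y : ℝ, |x - (c * A0 + (1 - c) * B0)| ≤ δ →
      |y - (c * A1 + (1 - c) * B1)| ≤ δ → y ≤ K' * x ^ p := by
  set m := min A0 B0 with hm
  have hm0 : 0 < m := lt_min hA hB
  have hev : ∀ᶠ δ in nhdsWithin (0 : ℝ) (Ioi 0),
      K + δ / m ^ p < K' * (1 - δ / m) ^ p ∧ δ < m := by
    have h1 : ContinuousAt (fun δ : ℝ => K' * (1 - δ / m) ^ p - (K + δ / m ^ p)) 0 := by
      refine ContinuousAt.sub (ContinuousAt.mul continuousAt_const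
        (ContinuousAt.rpow_const (by fun_prop) (Or.inr (by linarith)))) (by fun_prop)
    have h2 := h1.eventually (lt_mem_nhds (a := 0) (by simp; linarith))
    have h3 : ∀ᶠ δ in nhds (0 : ℝ), δ < m := gt_mem_nhds hm0
    filter_upwards [nhdsWithin_le_nhds h2, nhdsWithin_le_nhds h3] with δ h h'
    exact ⟨by linarith, h'⟩
  obtain ⟨δ, ⟨h1, h2⟩, hδ⟩ := (hev.and self_mem_nhdsWithin).exists
  have hδ : 0 < δ := hδ
  refine ⟨δ, hδ, fun c hc x y hx hy => ?_⟩
  have hs := hseg c hc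
  set X := c * A0 + (1 - c) * B0
  have hX : m ≤ X := by
    have := mul_le_mul_of_nonneg_left (min_le_left A0 B0) hc.1
    have := mul_le_mul_of_nonneg_left (min_le_right A0 B0) (sub_nonneg.2 hc.2)
    simp only [X, hm]; linarith
  have hq : 0 < 1 - δ / m := by rw [sub_pos, div_lt_one hm0]; exact h2
  have hx' : (1 - δ / m) * X ≤ x := by
    have h4 := (abs_le.1 hx).1
    have : δ ≤ δ / m * X := by
      rw [div_mul_eq_mul_div, le_div_iff₀ hm0]; gcongr
    linarith
  have hXp : m ^ p ≤ X ^ p := Real.rpow_le_rpow hm0.le hX (by linarith)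
  have hmp : 0 < m ^ p := Real.rpow_pos_of_pos hm0 p
  have h5 : ((1 - δ / m) * X) ^ p ≤ x ^ p :=
    Real.rpow_le_rpow (mul_nonneg hq.le (hm0.le.trans hX)) hx' (by linarith)
  rw [Real.mul_rpow hq.le (hm0.le.trans hX)] at h5
  have h6 : δ ≤ δ / m ^ p * X ^ p := by
    rw [div_mul_eq_mul_div, le_div_iff₀ hmp]; gcongr
  have h7 : (K + δ / m ^ p) * X ^ p ≤ K' * (1 - δ / m) ^ p * X ^ p :=
    mul_le_mul_of_nonneg_right h1.le (hmp.le.trans hXp)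
  have h8 := (abs_le.1 hy).2
  have h9 : K' * ((1 - δ / m) ^ p * X ^ p) ≤ K' * x ^ p := by
    gcongr
    linarith
  nlinarith

/-- A bi-infinite partition of `(u,v)` into intervals which are short compared with their distance
to the endpoints. -/
lemma exists_whitney {u v h : ℝ} (huv : u < v) (hh : 0 < h) :
    ∃ (τ : ℤ → ℝ) (idx : ℝ → ℤ), Measurable idx ∧ StrictMono τ ∧
      (∀ i, u < τ i ∧ τ i < v) ∧
      (∀ t ∈ Ioo u v, τ (idx t) ≤ t ∧ t < τ (idx t + 1)) ∧
      (∀ i, τ (i + 1) - τ i ≤ h * min (τ i - u) (v - τ (i + 1))) ∧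
      (∀ δ > 0, ∃ i, τ i - u < δ) ∧ (∀ δ > 0, ∃ i, v - τ i < δ) := by
  set L := v - u with hL
  have hL0 : 0 < L := sub_pos.2 huv
  set b := 1 + h with hb
  have hb1 : 1 < b := by linarith
  have hb0 : 0 < b := by linarith
  have hlb : 0 < Real.log b := Real.log_pos hb1
  have hpos : ∀ i : ℤ, 0 < b ^ i := fun i => zpow_pos hb0 i
  have hleft : ∀ x : ℝ, 0 < x → u + L * (x / (1 + x)) = v - L / (1 + x) := by
    intro x hx; field_simp; simp only [hL]; ring
  have hmono : StrictMono fun i : ℤ => u + L * (b ^ i / (1 + b ^ i)) := by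
    intro i j hij
    have h1 : b ^ i < b ^ j := zpow_lt_zpow_right₀ hb1 hij
    have := hpos i
    simp only [hleft _ (hpos _)]
    gcongr
  refine ⟨fun i => u + L * (b ^ i / (1 + b ^ i)),
    fun t => ⌊Real.log ((t - u) / (v - t)) / Real.log b⌋, ?_, hmono, ?_, ?_, ?_, ?_, ?_⟩
  · refine Int.measurable_floor.comp (Measurable.div_const (Real.measurable_log.comp ?_) _)
    exact (measurable_id.sub_const u).div (measurable_const.sub measurable_id)
  · intro i
    have := hpos i
    refine ⟨by simp only [lt_add_iff_pos_right]; positivity, ?_⟩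
    simp only [hleft _ this]
    have : 0 < L / (1 + b ^ i) := by positivity
    linarith
  · intro t ht
    have h1 : 0 < t - u := sub_pos.2 ht.1
    have h2 : 0 < v - t := sub_pos.2 ht.2
    set y := (t - u) / (v - t) with hy
    have hy0 : 0 < y := div_pos h1 h2
    have hty : t = u + L * (y / (1 + y)) := by
      have : 1 + y = L / (v - t) := by rw [hy]; field_simp; simp only [hL]; ring
      rw [this, hy]; field_simp; ring
    have e1 : b ^ ⌊Real.log y / Real.log b⌋ ≤ y := by
      rw [← Real.log_le_log_iff (hpos _) hy0, Real.log_zpow, ← le_div_iff₀ hlb]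
      exact Int.floor_le _
    have e2 : y < b ^ (⌊Real.log y / Real.log b⌋ + 1) := by
      rw [← Real.log_lt_log_iff hy0 (hpos _), Real.log_zpow, ← div_lt_iff₀ hlb]
      push_cast
      exact Int.lt_floor_add_one _
    have := hpos ⌊Real.log y / Real.log b⌋
    have hty' := hty.trans (hleft _ hy0)
    have k1 : u + L * (b ^ ⌊Real.log y / Real.log b⌋ / (1 + b ^ ⌊Real.log y / Real.log b⌋))
        ≤ v - L / (1 + y) := by
      rw [hleft _ this]; gcongr
    have k2 : v - L / (1 + y) < u + L * (b ^ (⌊Real.log y / Real.log b⌋ + 1) /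
        (1 + b ^ (⌊Real.log y / Real.log b⌋ + 1))) := by
      rw [hleft _ (hpos _)]; gcongr
    rw [← hty'] at k1 k2
    exact ⟨k1, k2⟩
  · intro i
    have hx := hpos i
    simp only [zpow_add_one₀ hb0.ne']
    set x := b ^ i
    rw [mul_min_of_nonneg _ _ hh.le, le_min_iff]
    have hx' : 0 < x * b := by positivity
    constructor
    · have : u + L * (x * b / (1 + x * b)) - (u + L * (x / (1 + x)))
        = L * ((b - 1) * x / ((1 + x) * (1 + x * b))) := by field_simp; ring
      rw [this, add_sub_cancel_left, hb, add_sub_cancel_left, ← hb]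
      rw [show h * (L * (x / (1 + x))) = L * (h * x / (1 + x)) by ring]
      gcongr
      nlinarith
    · rw [hleft _ hx, hleft _ hx']
      have : v - L / (1 + x * b) - (v - L / (1 + x))
        = L * ((b - 1) * x / ((1 + x) * (1 + x * b))) := by field_simp; ring
      rw [this, hb, add_sub_cancel_left, ← hb, sub_sub_cancel,
        show h * (L / (1 + x * b)) = L * (h / (1 + x * b)) by ring]
      gcongr L * ?_
      rw [div_le_div_iff₀ (by positivity) (by positivity)]
      have : 0 < h * (1 + x * b) := by positivity
      nlinarith
  · intro δ hδ
    obtain ⟨n, hn⟩ := exists_pow_lt_of_lt_one (div_pos hδ hL0) (inv_lt_one_of_one_lt₀ hb1)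
    refine ⟨-n, ?_⟩
    have hx := hpos (-n)
    simp only [add_sub_cancel_left]
    have e : b ^ (-(n : ℤ)) = b⁻¹ ^ n := by simp
    rw [← e, lt_div_iff₀ hL0] at hn
    refine lt_of_le_of_lt ?_ hn
    rw [mul_comm]
    gcongr
    exact div_le_self hx.le (by linarith)
  · intro δ hδ
    obtain ⟨n, hn⟩ := pow_unbounded_of_one_lt (L / δ) hb1
    refine ⟨n, ?_⟩
    have hx := hpos n
    simp only [hleft _ hx, sub_sub_cancel]
    rw [zpow_natCast] at hx ⊢
    rw [div_lt_iff₀ hδ] at hn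
    rw [div_lt_iff₀ (by positivity)]
    linarith

lemma integral_eq_zero_of_tiles {f : ℝ → ℝ} (hf : Measurable f) {M : ℝ} (hM : ∀ t, |f t| ≤ M)
    {u : ℝ} {τ : ℤ → ℝ} (hu : ∀ i, u < τ i) (hτ : ∀ δ > 0, ∃ i, τ i - u < δ)
    (h0 : ∀ i, ∫ t in τ i..τ (i + 1), f t = 0) (i : ℤ) : ∫ t in u..τ i, f t = 0 := by
  have hint := intervalIntegrable_of_bound hf hM
  have hM0 : 0 ≤ M := (abs_nonneg _).trans (hM 0)
  have hstep : ∀ i : ℤ, ∫ t in u..τ (i + 1), f t = ∫ t in u..τ i, f t := fun i => by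
    rw [← intervalIntegral.integral_add_adjacent_intervals (hint u (τ i)) (hint _ _), h0, add_zero]
  have h1 : Antitone fun i : ℤ => ∫ t in u..τ i, f t :=
    antitone_int_of_succ_le fun i => (hstep i).le
  have h2 : Monotone fun i : ℤ => ∫ t in u..τ i, f t :=
    monotone_int_of_le_succ fun i => (hstep i).ge
  have hconst : ∀ i j : ℤ, ∫ t in u..τ i, f t = ∫ t in u..τ j, f t := fun i j => by
    rcases le_total i j with h | h
    · exact le_antisymm (h2 h) (h1 h)
    · exact le_antisymm (h1 h) (h2 h)
  by_contra hne
  have hpos : 0 < |∫ t in u..τ i, f t| := abs_pos.2 hne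
  obtain ⟨j, hj⟩ := hτ (|∫ t in u..τ i, f t| / (M + 1)) (by positivity)
  have hb := intervalIntegral.norm_integral_le_of_norm_le_const (a := u) (b := τ j) (f := f)
    (C := M) fun x _ => hM x
  rw [Real.norm_eq_abs, hconst j i, abs_of_pos (sub_pos.2 (hu j))] at hb
  rw [lt_div_iff₀ (by positivity)] at hj
  nlinarith [hu j]

set_option maxHeartbeats 1600000 in
lemma Realizable.convex {p e C K : ℝ} (hp : 1 < p) (hK : 0 < K) {A B : Fin 3 → ℝ}
    (hA : Realizable p e C K A) (hB : Realizable p e C K B) (hA0 : 0 < A 0) (hB0 : 0 < B 0)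
    {θ : ℝ} (hθ : 0 < θ) (hθ1 : θ < 1)
    (hseg : ∀ c ∈ Icc (0 : ℝ) 1, c * A 1 + (1 - c) * B 1 ≤ K * (c * A 0 + (1 - c) * B 0) ^ p) :
    Realizable p e C K (fun j => (1 - θ) * A j + θ * B j) := by
  obtain ⟨cA, hcA, hA⟩ := hA
  obtain ⟨cB, hcB, hB⟩ := hB
  set c := min cA cB with hc
  have hc0 : 0 < c := lt_min hcA hcB
  refine ⟨c, hc0, fun K' hK' η hη u v huv => ?_⟩
  obtain ⟨δ, hδ, hpert⟩ := exists_perturbation hp hK hK' hA0 hB0 hseg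
  set X : Fin 3 → ℝ := fun j => (1 - θ) * A j + θ * B j with hX
  set ε := momentExp p e with hε
  have hη' : 0 < δ / 2 := by linarith
  set M := ∑ j, (c ^ ε j + |C| ^ ε j + |A j| + |B j|) with hM
  have hMj : ∀ j, c ^ ε j + |C| ^ ε j + |A j| + |B j| ≤ M := fun j =>
    Finset.single_le_sum (f := fun j => c ^ ε j + |C| ^ ε j + |A j| + |B j|)
      (fun _ _ => by positivity) (Finset.mem_univ j)
  have hM0 : 0 ≤ M := le_trans (by positivity) (hMj 0)
  have hdevM : ∀ j x y, c ≤ x → x ≤ C → |y| ≤ |A j| + |B j| → |x ^ ε j - y| ≤ M := by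
    intro j x y h1 h2 h3
    have h4 := rpow_le_add_of_mem_Icc hc0 h1 (h2.trans (le_abs_self C)) (ε j)
    have h5 : 0 ≤ x ^ ε j := Real.rpow_nonneg (hc0.le.trans h1) _
    have h6 := hMj j
    have h7 := abs_sub (x ^ ε j) y
    rw [abs_of_nonneg h5] at h7
    linarith
  set η₀ := min η δ with hη₀
  have hη₀0 : 0 < η₀ := lt_min hη hδ
  obtain ⟨τ, idx, hidx, hτ, hτuv, hidx', hwh, hτu, hτv⟩ :=
    exists_whitney (h := η₀ / (M + 1)) huv (by positivity)
  have hττ : ∀ i, τ i < τ (i + 1) := fun i => hτ (lt_add_one i)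
  set ρ : ℤ → ℝ := fun i => τ i + (1 - θ) * (τ (i + 1) - τ i) with hρ
  have hρ1 : ∀ i, τ i < ρ i := fun i => by
    have := mul_pos (sub_pos.2 hθ1) (sub_pos.2 (hττ i))
    simp only [hρ]; linarith
  have hρ2 : ∀ i, ρ i < τ (i + 1) := fun i => by
    have := mul_pos hθ (sub_pos.2 (hττ i))
    simp only [hρ]; linarith
  choose wA hwAm hwAb hwAp using fun i => hA K' hK' (δ / 2) hη' (τ i) (ρ i) (hρ1 i)
  choose wB hwBm hwBb hwBp using fun i => hB K' hK' (δ / 2) hη' (ρ i) (τ (i + 1)) (hρ2 i)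
  have hset : MeasurableSet {t : ℝ | t < ρ (idx t)} :=
    measurableSet_lt measurable_id ((measurable_of_countable ρ).comp hidx)
  have hglue : ∀ W : ℤ → ℝ → ℝ, (∀ i, Measurable (W i)) → Measurable fun t => W (idx t) t :=
    fun W hW => (measurable_from_prod_countable_left (f := fun q : ℝ × ℤ => W q.2 q.1)
      fun i => hW i).comp (measurable_id.prodMk hidx)
  set w : ℝ → ℝ := fun t => if t < ρ (idx t) then wA (idx t) t else wB (idx t) t with hw
  set χ : ℝ → ℝ := fun t => if t < ρ (idx t) then 1 else 0 with hχ
  have hwm : Measurable w := Measurable.ite hset (hglue wA hwAm) (hglue wB hwBm)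
  have hχm : Measurable χ := Measurable.ite hset measurable_const measurable_const
  have hwb : ∀ t, c ≤ w t ∧ w t ≤ C := fun t => by
    simp only [hw]
    split_ifs
    · exact ⟨(min_le_left _ _).trans (hwAb _ t).1, (hwAb _ t).2⟩
    · exact ⟨(min_le_right _ _).trans (hwBb _ t).1, (hwBb _ t).2⟩
  have hχ01 : ∀ t, 0 ≤ χ t ∧ χ t ≤ 1 := fun t => by
    simp only [hχ]
    split_ifs <;> simp
  have hidx_eq : ∀ i t, τ i ≤ t → t < τ (i + 1) → idx t = i := by
    intro i t h1 h2
    have h3 := hidx' t ⟨(hτuv i).1.trans_le h1, h2.trans (hτuv _).2⟩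
    have h4 := hτ.lt_iff_lt.1 (h1.trans_lt h3.2)
    have h5 := hτ.lt_iff_lt.1 (h3.1.trans_lt h2)
    omega
  have hwA : ∀ i t, t ∈ Ioo (τ i) (ρ i) → w t = wA i t ∧ χ t = 1 := fun i t ht => by
    simp only [hw, hχ, hidx_eq i t ht.1.le (ht.2.trans (hρ2 i)), ht.2, if_true, and_self]
  have hwB : ∀ i t, t ∈ Ioo (ρ i) (τ (i + 1)) → w t = wB i t ∧ χ t = 0 := fun i t ht => by
    simp only [hw, hχ, hidx_eq i t ((hρ1 i).trans ht.1).le ht.2, ht.1.le.not_gt, if_false,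
      and_self]
  have hwεm : ∀ j, Measurable fun t => w t ^ ε j := fun j => hwm.pow_const _
  -- the deviations from `X` and from the step function with values `A`, `B`
  set f : Fin 3 → ℝ → ℝ := fun j t => w t ^ ε j - X j with hf
  set g : Fin 3 → ℝ → ℝ := fun j t => w t ^ ε j - (B j + (A j - B j) * χ t) with hg
  have hfm : ∀ j, Measurable (f j) := fun j => (hwεm j).sub_const _
  have hgm : ∀ j, Measurable (g j) := fun j =>
    (hwεm j).sub ((hχm.const_mul _).const_add _)
  have hcomb : ∀ j (x : ℝ), 0 ≤ x → x ≤ 1 → |B j + (A j - B j) * x| ≤ |A j| + |B j| := by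
    intro j x h0 h1
    have : B j + (A j - B j) * x = x * A j + (1 - x) * B j := by ring
    rw [this]
    refine (abs_add_le _ _).trans ?_
    rw [abs_mul, abs_mul, abs_of_nonneg h0, abs_of_nonneg (sub_nonneg.2 h1)]
    nlinarith [abs_nonneg (A j), abs_nonneg (B j)]
  have hfM : ∀ j t, |f j t| ≤ M := fun j t => hdevM j _ _ (hwb t).1 (hwb t).2 (by
    have := hcomb j (1 - θ) (by linarith) (by linarith)
    rwa [show B j + (A j - B j) * (1 - θ) = X j by simp only [hX]; ring] at this)
  have hgM : ∀ j t, |g j t| ≤ M := fun j t => hdevM j _ _ (hwb t).1 (hwb t).2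
    (hcomb j _ (hχ01 t).1 (hχ01 t).2)
  have hfi := fun j => intervalIntegrable_of_bound (hfm j) (hfM j)
  have hgi := fun j => intervalIntegrable_of_bound (hgm j) (hgM j)
  have hgA : ∀ i j s, s ∈ Icc (τ i) (ρ i) →
      ∫ t in τ i..s, g j t = ∫ t in τ i..s, (wA i t ^ ε j - A j) := fun i j s hs => by
    refine intervalIntegral.integral_congr_Ioo_of_le hs.1 fun t ht => ?_
    obtain ⟨h1, h2⟩ := hwA i t ⟨ht.1, ht.2.trans_le hs.2⟩
    simp only [hg, h1, h2]; ring
  have hgB : ∀ i j s, s ∈ Icc (ρ i) (τ (i + 1)) →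
      ∫ t in ρ i..s, g j t = ∫ t in ρ i..s, (wB i t ^ ε j - B j) := fun i j s hs => by
    refine intervalIntegral.integral_congr_Ioo_of_le hs.1 fun t ht => ?_
    obtain ⟨h1, h2⟩ := hwB i t ⟨ht.1, ht.2.trans_le hs.2⟩
    simp only [hg, h1, h2]; ring
  have hgA0 : ∀ i j, ∫ t in τ i..ρ i, g j t = 0 := fun i j => by
    have := (hwAp i).dev j (ρ i) ⟨(hρ1 i).le, le_rfl⟩
    rw [sub_self, min_eq_right (sub_nonneg.2 (hρ1 i).le), mul_zero] at this
    rw [hgA i j _ ⟨(hρ1 i).le, le_rfl⟩]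
    exact abs_nonpos_iff.1 this
  have hgB0 : ∀ i j, ∫ t in ρ i..τ (i + 1), g j t = 0 := fun i j => by
    have := (hwBp i).dev j (τ (i + 1)) ⟨(hρ2 i).le, le_rfl⟩
    rw [sub_self, min_eq_right (sub_nonneg.2 (hρ2 i).le), mul_zero] at this
    rw [hgB i j _ ⟨(hρ2 i).le, le_rfl⟩]
    exact abs_nonpos_iff.1 this
  have hgt : ∀ i j, ∫ t in τ i..τ (i + 1), g j t = 0 := fun i j => by
    rw [← intervalIntegral.integral_add_adjacent_intervals (hgi j (τ i) (ρ i)) (hgi j _ _),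
      hgA0, hgB0, add_zero]
  have hgτ : ∀ i j, ∫ t in u..τ i, g j t = 0 := fun i j =>
    integral_eq_zero_of_tiles (hgm j) (hgM j) (fun i => (hτuv i).1) hτu (fun i => hgt i j) i
  have hgρ : ∀ i j, ∫ t in u..ρ i, g j t = 0 := fun i j => by
    rw [← intervalIntegral.integral_add_adjacent_intervals (hgi j u (τ i)) (hgi j _ _),
      hgτ, hgA0, add_zero]
  have hχi : ∀ a b, IntervalIntegrable χ volume a b :=
    intervalIntegrable_of_bound hχm (M := 1) fun t => by
      rw [abs_of_nonneg (hχ01 t).1]; exact (hχ01 t).2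
  have hfg : ∀ j a b, ∫ t in a..b, f j t =
      (∫ t in a..b, g j t) + (B j - X j) * (b - a) + (A j - B j) * ∫ t in a..b, χ t := by
    intro j a b
    have : f j = fun t => g j t + ((B j - X j) + (A j - B j) * χ t) := by
      funext t; simp only [hf, hg]; ring
    rw [this, intervalIntegral.integral_add (hgi j a b)
      (intervalIntegrable_const.add ((hχi a b).const_mul _)),
      intervalIntegral.integral_add intervalIntegrable_const ((hχi a b).const_mul _),
      intervalIntegral.integral_const, intervalIntegral.integral_const_mul]
    simp only [smul_eq_mul]; ring
  have hχA : ∀ i, ∫ t in τ i..ρ i, χ t = ρ i - τ i := fun i => by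
    rw [intervalIntegral.integral_congr_Ioo_of_le (g := fun _ => (1 : ℝ)) (hρ1 i).le
      fun t ht => (hwA i t ht).2]
    simp
  have hχB : ∀ i, ∫ t in ρ i..τ (i + 1), χ t = 0 := fun i => by
    rw [intervalIntegral.integral_congr_Ioo_of_le (g := fun _ => (0 : ℝ)) (hρ2 i).le
      fun t ht => (hwB i t ht).2]
    simp
  have hft : ∀ i j, ∫ t in τ i..τ (i + 1), f j t = 0 := fun i j => by
    rw [hfg, hgt, ← intervalIntegral.integral_add_adjacent_intervals (hχi (τ i) (ρ i)) (hχi _ _),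
      hχA, hχB]
    simp only [hX, hρ]; ring
  have hfτ : ∀ i j, ∫ t in u..τ i, f j t = 0 := fun i j =>
    integral_eq_zero_of_tiles (hfm j) (hfM j) (fun i => (hτuv i).1) hτu (fun i => hft i j) i
  have hfbound : ∀ j a b, a ≤ b → |∫ t in a..b, f j t| ≤ M * (b - a) := fun j a b hab => by
    have := intervalIntegral.norm_integral_le_of_norm_le_const (a := a) (b := b) (f := f j)
      (C := M) fun x _ => hfM j x
    rwa [Real.norm_eq_abs, abs_of_nonneg (sub_nonneg.2 hab)] at this
  have hdev₀ : ∀ j, ∀ s ∈ Icc u v, |∫ t in u..s, f j t| ≤ η₀ * min (s - u) (v - s) := by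
    intro j s hs
    rcases eq_or_lt_of_le hs.1 with rfl | hus
    · simp [sub_nonneg.2 huv.le]
    rcases eq_or_lt_of_le hs.2 with rfl | hsv
    · rw [sub_self, min_eq_right (sub_nonneg.2 huv.le), mul_zero]
      by_contra! hne
      obtain ⟨i, hi⟩ := hτv (|∫ t in u..s, f j t| / (M + 1)) (by positivity)
      rw [← intervalIntegral.integral_add_adjacent_intervals (hfi j u (τ i)) (hfi j _ _),
        hfτ, zero_add] at hi hne
      have := hfbound j (τ i) s (hτuv i).2.le
      rw [lt_div_iff₀ (by positivity)] at hi
      nlinarith [(hτuv i).2]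
    obtain ⟨h1, h2⟩ := hidx' s ⟨hus, hsv⟩
    set i := idx s
    rw [← intervalIntegral.integral_add_adjacent_intervals (hfi j u (τ i)) (hfi j _ _),
        hfτ, zero_add]
    have h3 := hfbound j (τ i) s h1
    have h4 := hwh i
    have h5 : min (τ i - u) (v - τ (i + 1)) ≤ min (s - u) (v - s) :=
      min_le_min (by linarith) (by linarith)
    have h6 : 0 ≤ min (s - u) (v - s) := le_min (by linarith) (by linarith)
    calc _ ≤ M * (s - τ i) := h3
      _ ≤ (M + 1) * (η₀ / (M + 1) * min (s - u) (v - s)) := by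
        have : η₀ / (M + 1) * min (τ i - u) (v - τ (i + 1)) ≤
          η₀ / (M + 1) * min (s - u) (v - s) := by gcongr
        gcongr <;> linarith
      _ = _ := by field_simp
  have hpart : ∀ s ∈ Ioo u v, ∃ β β', β ≤ s ∧ s ≤ β' ∧
      (∀ j, |∫ t in u..s, g j t| ≤ δ / 2 * min (s - β) (β' - s)) ∧
      (∀ a b, β ≤ a → a < b → b ≤ β' → RevHolderOn p K' w a b) := by
    intro s hs
    obtain ⟨h1, h2⟩ := hidx' s hs
    set i := idx s
    rcases lt_or_ge s (ρ i) with h | h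
    · refine ⟨τ i, ρ i, h1, h.le, fun j => ?_, fun a b ha hab hb => ?_⟩
      · rw [← intervalIntegral.integral_add_adjacent_intervals (hgi j u (τ i)) (hgi j _ _),
          hgτ, zero_add, hgA i j s ⟨h1, h.le⟩]
        exact (hwAp i).dev j s ⟨h1, h.le⟩
      · have := (hwAp i).rh a b ha hab hb
        have hEq : EqOn w (wA i) (Ioo a b) := fun t ht =>
          (hwA i t ⟨ha.trans_lt ht.1, ht.2.trans_le hb⟩).1
        unfold RevHolderOn at this ⊢
        rwa [intervalIntegral.integral_congr_Ioo_of_le hab.le hEq,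
          intervalIntegral.integral_congr_Ioo_of_le (g := fun r => wA i r ^ p) hab.le
            fun t ht => by simp only [hEq ht]]
    · refine ⟨ρ i, τ (i + 1), h, h2.le, fun j => ?_, fun a b ha hab hb => ?_⟩
      · rw [← intervalIntegral.integral_add_adjacent_intervals (hgi j u (ρ i)) (hgi j _ _),
          hgρ, zero_add, hgB i j s ⟨h, h2.le⟩]
        exact (hwBp i).dev j s ⟨h, h2.le⟩
      · have := (hwBp i).rh a b ha hab hb
        have hEq : EqOn w (wB i) (Ioo a b) := fun t ht =>
          (hwB i t ⟨ha.trans_lt ht.1, ht.2.trans_le hb⟩).1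
        unfold RevHolderOn at this ⊢
        rwa [intervalIntegral.integral_congr_Ioo_of_le hab.le hEq,
          intervalIntegral.integral_congr_Ioo_of_le (g := fun r => wB i r ^ p) hab.le
            fun t ht => by simp only [hEq ht]]
  -- averages close to the segment `[A, B]` satisfy the reverse Hölder inequality
  have hclose : ∀ s t x, s < t → x ∈ Icc (0 : ℝ) 1 →
      (∀ j, |∫ r in s..t, (w r ^ ε j - (x * A j + (1 - x) * B j))| ≤ δ * (t - s)) →
      RevHolderOn p K' w s t := by
    intro s t x hst hx h
    have hts : 0 < t - s := sub_pos.2 hst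
    have hwi : ∀ j, IntervalIntegrable (fun r => w r ^ ε j) volume s t := fun j =>
      (intervalIntegrable_of_bound (hwεm j) (M := M) fun r => by
        simpa using hdevM j _ 0 (hwb r).1 (hwb r).2 (by simp; positivity)) s t
    have h' : ∀ j, |(∫ r in s..t, w r ^ ε j) / (t - s) - (x * A j + (1 - x) * B j)| ≤ δ := by
      intro j
      have := h j
      rw [intervalIntegral.integral_sub (hwi j) intervalIntegrable_const,
        intervalIntegral.integral_const, smul_eq_mul] at this
      rw [show (∫ r in s..t, w r ^ ε j) / (t - s) - (x * A j + (1 - x) * B j) =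
        ((∫ r in s..t, w r ^ ε j) - (t - s) * (x * A j + (1 - x) * B j)) / (t - s) by
          field_simp, abs_div, abs_of_pos hts, div_le_iff₀ hts]
      exact this
    have e0 : ε 0 = 1 := rfl
    have e1 : ε 1 = p := rfl
    have h0 := h' 0
    have h1 := h' 1
    simp only [e0, Real.rpow_one] at h0
    rw [e1] at h1
    exact hpert x hx _ _ h0 h1
  refine ⟨w, hwm, hwb, fun j s hs => (hdev₀ j s hs).trans ?_, fun s t hus hst htv => ?_⟩
  · have : 0 ≤ min (s - u) (v - s) := le_min (sub_nonneg.2 hs.1) (sub_nonneg.2 hs.2)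
    exact mul_le_mul_of_nonneg_right (min_le_left _ _) this
  have hts : 0 < t - s := sub_pos.2 hst
  rcases eq_or_lt_of_le hus with rfl | hus
  · refine hclose u t (1 - θ) hst ⟨by linarith, by linarith⟩ fun j => ?_
    rw [sub_sub_cancel]
    refine (hdev₀ j t ⟨hst.le, htv⟩).trans ?_
    exact mul_le_mul (min_le_right _ _) (min_le_left _ _)
      (le_min hts.le (sub_nonneg.2 htv)) hδ.le
  rcases eq_or_lt_of_le htv with rfl | htv
  · refine hclose s t (1 - θ) hst ⟨by linarith, by linarith⟩ fun j => ?_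
    rw [sub_sub_cancel]
    have h1 := hdev₀ j s ⟨hus.le, hst.le⟩
    have h2 := hdev₀ j t ⟨huv.le, le_rfl⟩
    rw [sub_self, min_eq_right (sub_nonneg.2 huv.le), mul_zero] at h2
    have h3 := intervalIntegral.integral_add_adjacent_intervals (hfi j u s) (hfi j s t)
    rw [abs_nonpos_iff.1 h2] at h3
    change |∫ r in s..t, f j r| ≤ _
    rw [← abs_neg, ← eq_neg_of_add_eq_zero_left h3]
    exact h1.trans (mul_le_mul (min_le_right _ _) (min_le_right _ _)
      (le_min (sub_nonneg.2 hus.le) hts.le) hδ.le)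
  obtain ⟨β, β', hβ, hβ', hgs, hrs⟩ := hpart s ⟨hus, hst.trans htv⟩
  obtain ⟨γ, γ', hγ, hγ', hgt', hrt⟩ := hpart t ⟨hus.trans hst, htv⟩
  rcases le_or_gt t β' with h | h
  · exact hrs s t hβ hst h
  rcases le_or_gt γ s with h' | h'
  · exact hrt s t h' hst hγ'
  have hts' : t - s ≠ 0 := hts.ne'
  set N := ∫ r in s..t, χ r with hN
  have hN0 : 0 ≤ N := intervalIntegral.integral_nonneg hst.le fun r _ => (hχ01 r).1
  have hN1 : N ≤ t - s := by
    have := intervalIntegral.integral_mono hst.le (hχi s t)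
      (intervalIntegrable_const (c := (1 : ℝ))) fun r => (hχ01 r).2
    simpa using this
  refine hclose s t (N / (t - s)) hst ⟨by positivity, (div_le_one hts).2 hN1⟩ fun j => ?_
  have e1 : ∫ r in s..t, (w r ^ ε j - (N / (t - s) * A j + (1 - N / (t - s)) * B j)) =
      ∫ r in s..t, g j r := by
    have h1 : ∀ r, w r ^ ε j - (N / (t - s) * A j + (1 - N / (t - s)) * B j) =
        f j r + (X j - (N / (t - s) * A j + (1 - N / (t - s)) * B j)) := fun r => by
      simp only [hf]; ring
    simp only [h1]
    rw [intervalIntegral.integral_add (hfi j s t) intervalIntegrable_const, hfg,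
      intervalIntegral.integral_const, smul_eq_mul, ← hN]
    field_simp
    ring
  have e2 := intervalIntegral.integral_add_adjacent_intervals (hgi j u s) (hgi j s t)
  have e3 : |∫ r in u..s, g j r| ≤ δ / 2 * (t - s) :=
    (hgs j).trans (mul_le_mul_of_nonneg_left ((min_le_right _ _).trans (by linarith)) hη'.le)
  have e4 : |∫ r in u..t, g j r| ≤ δ / 2 * (t - s) :=
    (hgt' j).trans (mul_le_mul_of_nonneg_left ((min_le_left _ _).trans (by linarith)) hη'.le)
  rw [e1, eq_sub_of_add_eq' e2]
  refine (abs_sub _ _).trans ?_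
  linarith

lemma realizable_const {p e C K μ : ℝ} (hμ : 0 < μ) (hμC : μ ≤ C) (hK : 1 ≤ K) :
    Realizable p e C K (fun j => μ ^ momentExp p e j) := by
  refine ⟨μ, hμ, fun K' hK' η hη u v huv => ⟨fun _ => μ, measurable_const,
    fun _ => ⟨le_rfl, hμC⟩, fun j s hs => ?_, fun s t _ hst _ => ?_⟩⟩
  · have : 0 ≤ min (s - u) (v - s) := le_min (sub_nonneg.2 hs.1) (sub_nonneg.2 hs.2)
    simp only [sub_self, intervalIntegral.integral_zero, abs_zero]
    positivity
  · have hts : t - s ≠ 0 := (sub_pos.2 hst).ne'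
    simp only [RevHolderOn, intervalIntegral.integral_const, smul_eq_mul, mul_div_cancel_left₀ _ hts]
    have : 0 < μ ^ p := Real.rpow_pos_of_pos hμ p
    nlinarith

lemma Realizable.scale {p e C K σ : ℝ} {X : Fin 3 → ℝ} (h : Realizable p e C K X) (hσ : 0 < σ)
    (hσ1 : σ ≤ 1) : Realizable p e C K (fun j => σ ^ momentExp p e j * X j) := by
  obtain ⟨c, hc, h⟩ := h
  refine ⟨σ * c, by positivity, fun K' hK' η hη u v huv => ?_⟩
  set S := ∑ j, σ ^ momentExp p e j with hS
  have hSj : ∀ j, σ ^ momentExp p e j ≤ S := fun j =>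
    Finset.single_le_sum (f := fun j => σ ^ momentExp p e j)
      (fun _ _ => by positivity) (Finset.mem_univ j)
  have hS0 : 0 < S := (Real.rpow_pos_of_pos hσ _).trans_le (hSj 0)
  obtain ⟨w, hwm, hwb, hw⟩ := h K' hK' (η / S) (by positivity) u v huv
  have hw0 : ∀ t, 0 ≤ w t := fun t => hc.le.trans (hwb t).1
  refine ⟨fun t => σ * w t, hwm.const_mul σ, fun t => ⟨?_, ?_⟩, fun j s hs => ?_,
    fun s t hs hst ht => ?_⟩
  · exact mul_le_mul_of_nonneg_left (hwb t).1 hσ.le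
  · exact (mul_le_of_le_one_left (hw0 t) hσ1).trans (hwb t).2
  · simp only [Real.mul_rpow hσ.le (hw0 _), ← mul_sub, intervalIntegral.integral_const_mul]
    have hm : 0 ≤ min (s - u) (v - s) := le_min (sub_nonneg.2 hs.1) (sub_nonneg.2 hs.2)
    rw [abs_mul, abs_of_pos (Real.rpow_pos_of_pos hσ _)]
    calc _ ≤ S * (η / S * min (s - u) (v - s)) :=
          mul_le_mul (hSj j) (hw.dev j s hs) (abs_nonneg _) hS0.le
      _ = _ := by field_simp
  · have h1 := hw.rh s t hs hst ht
    have hts : 0 < t - s := sub_pos.2 hst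
    have h0 : 0 ≤ ∫ r in s..t, w r := intervalIntegral.integral_nonneg hst.le fun r _ => hw0 r
    unfold RevHolderOn at h1 ⊢
    simp only [Real.mul_rpow hσ.le (hw0 _), intervalIntegral.integral_const_mul, mul_div_assoc]
    rw [Real.mul_rpow hσ.le (by positivity)]
    have := mul_le_mul_of_nonneg_left h1 (Real.rpow_nonneg hσ.le p)
    linarith

/-- A sequence that moves at least the fraction `ρ` of the way towards `L` in each step. -/
lemma contraction_step {ρ L y y' D : ℝ} {n : ℕ} (hρ : ρ ≤ 1) (hy : L - (1 - ρ) ^ n * D ≤ y)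
    (hy' : (1 - ρ) * y + ρ * L ≤ y') : L - (1 - ρ) ^ (n + 1) * D ≤ y' := by
  have := mul_le_mul_of_nonneg_left hy (sub_nonneg.2 hρ)
  rw [pow_succ]
  linarith

lemma eventually_lt_of_contraction {ρ L l : ℝ} (D : ℝ) (hρ0 : 0 < ρ) (hρ : ρ ≤ 1) (hl : l < L) :
    ∀ᶠ n : ℕ in atTop, l < L - (1 - ρ) ^ n * D := by
  have h := (tendsto_pow_atTop_nhds_zero_of_lt_one (sub_nonneg.2 hρ)
    (by linarith : 1 - ρ < 1)).mul_const D
  have h2 := h.const_sub L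
  rw [zero_mul, sub_zero] at h2
  exact h2.eventually (lt_mem_nhds hl)

lemma one_add_mul_le_rpow_neg {x q : ℝ} (hx : x < 1) (hq : 0 ≤ q) :
    1 + q * x ≤ (1 - x) ^ (-q) := by
  have h : 0 < 1 - x := by linarith
  rw [Real.rpow_def_of_pos h]
  have h1 := Real.add_one_le_exp (Real.log (1 - x) * -q)
  have h2 := Real.log_le_sub_one_of_pos h
  nlinarith

/-- One step of the discretised power weight construction. -/
lemma Realizable.step {p a b θ K κ κ' z : ℝ} (hp : 1 < p) (hb : 0 < b) (hba : b < a)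
    (hθ : 0 < θ) (hθ1 : θ < 1) (hbθ : b * θ < 1) (hK : 1 ≤ K) (hκ : κ ≤ κ')
    (h1 : (1 + b) ^ p * (1 + p * b * θ) ≤ κ' * (1 + p * b))
    (h2 : κ' ≤ K * (1 - b * θ) ^ p)
    (h : Realizable p (-1 / a) (1 + a) K ![1, κ, z]) :
    Realizable p (-1 / a) (1 + a) K
      ![1, (1 - θ) * ((1 - b * θ) ^ p * κ) + θ * (1 + b - b * θ) ^ p,
        (1 - θ) * ((1 - b * θ) ^ (-1 / a) * z) + θ * (1 + b - b * θ) ^ (-1 / a)] := by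
  have hbθ0 : 0 < b * θ := by positivity
  have hμ : 0 < 1 + b - b * θ := by linarith
  have hσ : 0 < 1 - b * θ := by linarith
  have hc := (h.scale hσ (by linarith)).convex (e := -1 / a) (θ := θ) hp (by linarith)
    (realizable_const hμ (by linarith) hK) (by simpa [momentExp] using hσ)
    (by simpa [momentExp] using hμ) hθ hθ1 ?_
  · convert hc using 1
    funext j
    fin_cases j <;> simp [momentExp]
    ring
  · intro c hc
    simp only [momentExp, Matrix.cons_val_zero, Matrix.cons_val_one, Real.rpow_one, mul_one]
    have hpb : 0 < p * b := by positivity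
    have hB : 0 ≤ (1 + b) ^ p := by positivity
    have hκ'0 : 0 ≤ κ' := by
      by_contra! hneg
      nlinarith [mul_nonneg hB (by positivity : 0 ≤ 1 + p * b * θ)]
    have hB2 : (1 + b) ^ p ≤ κ' * (1 + p * b) :=
      le_trans (le_mul_of_one_le_right hB (by nlinarith [mul_pos hpb hθ])) h1
    have e1 : (1 - b * θ) ^ p * κ ≤ κ' := by
      have hle : (1 - b * θ) ^ p ≤ 1 := Real.rpow_le_one hσ.le (by linarith) (by linarith)
      have : 0 ≤ (1 - b * θ) ^ p := by positivity
      nlinarith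
    have e2 : (1 + b - b * θ) ^ p ≤ κ' * (1 + p * b) :=
      (Real.rpow_le_rpow hμ.le (by linarith) (by linarith)).trans hB2
    have hc1 : 0 ≤ 1 - c := sub_nonneg.2 hc.2
    have e3 : 1 + p * ((1 - c) * b) ≤ (1 + (1 - c) * b) ^ p :=
      one_add_mul_self_le_rpow_one_add (by nlinarith) hp.le
    have hcb : 0 ≤ (1 - c) * b := by positivity
    have e4 : (1 - b * θ) * (1 + (1 - c) * b) ≤
        c * (1 - b * θ) + (1 - c) * (1 + b - b * θ) := by nlinarith
    have e5 := Real.rpow_le_rpow (by positivity) e4 (by linarith : 0 ≤ p)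
    rw [Real.mul_rpow hσ.le (by positivity)] at e5
    calc c * ((1 - b * θ) ^ p * κ) + (1 - c) * (1 + b - b * θ) ^ p
        ≤ c * κ' + (1 - c) * (κ' * (1 + p * b)) :=
          add_le_add (mul_le_mul_of_nonneg_left e1 hc.1) (mul_le_mul_of_nonneg_left e2 hc1)
      _ = κ' * (1 + p * ((1 - c) * b)) := by ring
      _ ≤ κ' * (1 + (1 - c) * b) ^ p := mul_le_mul_of_nonneg_left e3 hκ'0
      _ ≤ K * (1 - b * θ) ^ p * (1 + (1 - c) * b) ^ p := by gcongr
      _ = K * ((1 - b * θ) ^ p * (1 + (1 - c) * b) ^ p) := by ring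
      _ ≤ _ := mul_le_mul_of_nonneg_left e5 (by linarith)

lemma exists_realizable_of_params {p a b θ K κ' l m : ℝ} (hp : 1 < p) (ha : 0 < a) (hb : 0 < b)
    (hba : b < a) (hθ : 0 < θ) (hθ1 : θ * (1 + p * b) < 1) (hK : 1 ≤ K) (hκ' : 1 ≤ κ')
    (h1 : (1 + b) ^ p * (1 + p * b * θ) ≤ κ' * (1 + p * b))
    (h2 : κ' ≤ K * (1 - b * θ) ^ p)
    (hl : l < (1 + b - b * θ) ^ p / (1 + p * b))
    (hm : m < (1 + a) ^ (-1 / a) / (1 - b / a + b / a * θ)) :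
    ∃ κ z, κ ≤ κ' ∧ l < κ ∧ m < z ∧ Realizable p (-1 / a) (1 + a) K ![1, κ, z] := by
  have hpb : 0 < p * b := by positivity
  have hθ1' : θ < 1 := by nlinarith
  have hbθ : b * θ < 1 := by nlinarith [mul_pos hb hθ]
  have hbθ0 : 0 < b * θ := by positivity
  have hσ : 0 < 1 - b * θ := by linarith
  have hμ : 0 < 1 + b - b * θ := by linarith
  set L₁ := (1 + b - b * θ) ^ p / (1 + p * b) with hL₁
  set d := 1 - b / a + b / a * θ with hd
  have hba' : b / a < 1 := (div_lt_one ha).2 hba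
  have hba0 : 0 < b / a := by positivity
  have hd0 : 0 < d := by nlinarith [mul_pos hba0 hθ]
  have hd1 : d ≤ 1 := by nlinarith
  set L₂ := (1 + a) ^ (-1 / a) / d with hL₂
  set ρ₁ := θ * (1 + p * b) with hρ₁
  set ρ₂ := θ * d with hρ₂
  have hρ₂1 : ρ₂ ≤ 1 := by nlinarith
  have hρ₁0 : 0 < ρ₁ := by positivity
  have hρ₂0 : 0 < ρ₂ := by positivity
  have key : ∀ n : ℕ, ∃ κ z, κ ≤ κ' ∧ 0 ≤ κ ∧ 0 ≤ z ∧ L₁ - (1 - ρ₁) ^ n * (L₁ - 1) ≤ κ ∧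
      L₂ - (1 - ρ₂) ^ n * L₂ ≤ z ∧ Realizable p (-1 / a) (1 + a) K ![1, κ, z] := by
    intro n
    induction n with
    | zero =>
      refine ⟨1, 1, hκ', zero_le_one, zero_le_one, by simp, by simp, ?_⟩
      convert realizable_const (p := p) (e := -1 / a) (C := 1 + a) one_pos (by linarith) hK using 1
      funext j
      fin_cases j <;> simp
    | succ n ih =>
      obtain ⟨κ, z, hκ, hκ0, hz0, hκL, hzL, hR⟩ := ih
      refine ⟨_, _, ?_, ?_, ?_, contraction_step hθ1.le hκL ?_, contraction_step hρ₂1 hzL ?_,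
        hR.step hp hb hba hθ hθ1' hbθ hK hκ h1 h2⟩
      · have e1 : (1 - b * θ) ^ p * (1 + p * (b * θ)) ≤ 1 := by
          have e2 : 1 + p * (b * θ) ≤ (1 + b * θ) ^ p :=
            one_add_mul_self_le_rpow_one_add (by linarith) hp.le
          calc _ ≤ (1 - b * θ) ^ p * (1 + b * θ) ^ p := by gcongr
            _ = ((1 - b * θ) * (1 + b * θ)) ^ p := by
              rw [Real.mul_rpow hσ.le (by positivity)]
            _ ≤ 1 := Real.rpow_le_one (by positivity) (by nlinarith) (by linarith)
        have e3 : (1 + b - b * θ) ^ p ≤ (1 + b) ^ p :=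
          Real.rpow_le_rpow hμ.le (by linarith) (by linarith)
        have hD : 0 < 1 + p * (b * θ) := by positivity
        refine le_of_mul_le_mul_right ?_ hD
        have e4 : (1 - θ) * ((1 - b * θ) ^ p * κ) * (1 + p * (b * θ)) ≤ (1 - θ) * κ' := by
          calc _ = (1 - θ) * ((1 - b * θ) ^ p * (1 + p * (b * θ)) * κ) := by ring
            _ ≤ (1 - θ) * (1 * κ') := by
              gcongr
            _ = _ := by ring
        have e5 : θ * (1 + b - b * θ) ^ p * (1 + p * (b * θ)) ≤ θ * (κ' * (1 + p * b)) := by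
          calc _ ≤ θ * (1 + b) ^ p * (1 + p * (b * θ)) := by gcongr
            _ = θ * ((1 + b) ^ p * (1 + p * b * θ)) := by ring
            _ ≤ _ := by gcongr
        linarith
      · have := sub_pos.2 hθ1'
        positivity
      · have := sub_pos.2 hθ1'
        positivity
      · have e1 : 1 + p * (-(b * θ)) ≤ (1 + -(b * θ)) ^ p :=
          one_add_mul_self_le_rpow_one_add (by linarith) hp.le
        rw [← sub_eq_add_neg] at e1
        have e2 : ρ₁ * L₁ = θ * (1 + b - b * θ) ^ p := by
          rw [hρ₁, hL₁]; field_simp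
        rw [e2]
        have e3 : (1 - ρ₁) ≤ (1 - θ) * (1 - b * θ) ^ p := by
          have := mul_le_mul_of_nonneg_left e1 (sub_pos.2 hθ1').le
          nlinarith [mul_pos (mul_pos hpb hθ) hθ]
        have := mul_le_mul_of_nonneg_right e3 hκ0
        linarith
      · have e1 : 1 + 1 / a * (b * θ) ≤ (1 - b * θ) ^ (-1 / a) := by
          rw [neg_div]; exact one_add_mul_le_rpow_neg hbθ (by positivity)
        have e2 : ρ₂ * L₂ = θ * (1 + a) ^ (-1 / a) := by
          rw [hρ₂, hL₂]; field_simp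
        have e3 : (1 + a) ^ (-1 / a) ≤ (1 + b - b * θ) ^ (-1 / a) :=
          Real.rpow_le_rpow_of_nonpos hμ (by linarith) (by rw [neg_div]; simp; positivity)
        rw [e2]
        have e4 : 1 - ρ₂ ≤ (1 - θ) * (1 - b * θ) ^ (-1 / a) := by
          have := mul_le_mul_of_nonneg_left e1 (sub_pos.2 hθ1').le
          have e5 : (1 - θ) * (1 + 1 / a * (b * θ)) = 1 - ρ₂ := by
            rw [hρ₂, hd]; field_simp; ring
          linarith
        have := mul_le_mul_of_nonneg_right e4 hz0
        have := mul_le_mul_of_nonneg_left e3 hθ.le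
        linarith
  obtain ⟨n, hn1, hn2⟩ := ((eventually_lt_of_contraction (L₁ - 1) hρ₁0 hθ1.le hl).and
    (eventually_lt_of_contraction L₂ hρ₂0 hρ₂1 hm)).exists
  obtain ⟨κ, z, hκ, -, -, hκL, hzL, hR⟩ := key n
  exact ⟨κ, z, hκ, hn1.trans_le hκL, hn2.trans_le hzL, hR⟩

lemma rpow_div_lt_of_lt {p a b : ℝ} (hp : 1 < p) (hb : 0 < b) (hba : b < a) :
    (1 + b) ^ p / (1 + p * b) < (1 + a) ^ p / (1 + p * a) := by
  have hpb : 0 < p * b := by positivity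
  have hpa : 0 < p * a := by nlinarith
  have hx : 0 < (a - b) / (1 + b) := div_pos (by linarith) (by linarith)
  have h1 := one_add_mul_self_lt_rpow_one_add (by linarith) hx.ne' hp
  have h2 : 1 + (a - b) / (1 + b) = (1 + a) / (1 + b) := by field_simp; ring
  rw [h2, Real.div_rpow (by linarith) (by linarith), lt_div_iff₀ (by positivity)] at h1
  have h3 : (1 + p * a) / (1 + p * b) ≤ 1 + p * ((a - b) / (1 + b)) := by
    have : (1 + p * a) / (1 + p * b) = 1 + p * ((a - b) / (1 + p * b)) := by field_simp; ring
    rw [this]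
    gcongr
    nlinarith
  rw [div_lt_div_iff₀ (by positivity) (by positivity)]
  have h4 : (1 + p * a) / (1 + p * b) * (1 + b) ^ p < (1 + a) ^ p :=
    (mul_le_mul_of_nonneg_right h3 (by positivity)).trans_lt h1
  rw [div_mul_eq_mul_div, div_lt_iff₀ (by positivity)] at h4
  linarith

/-- Moment vectors with reverse Hölder constant arbitrarily close to that of `x ^ a` from below and
with arbitrarily large moment of exponent `-1/a` are realizable. -/
lemma exists_realizable {p a l m : ℝ} (hp : 1 < p) (ha : 0 < a)
    (hl : l < (1 + a) ^ p / (1 + p * a)) :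
    ∃ K κ z, K < (1 + a) ^ p / (1 + p * a) ∧ κ < (1 + a) ^ p / (1 + p * a) ∧ l < κ ∧ m < z ∧
      Realizable p (-1 / a) (1 + a) K ![1, κ, z] := by
  have hpa : 0 < p * a := by positivity
  have hc0 : 0 < (1 + a) ^ (-1 / a) := by positivity
  have hev : ∀ᶠ b in nhdsWithin a (Iio a), l < (1 + b) ^ p / (1 + p * b) ∧ 0 < b ∧
      m * (1 - b / a) < (1 + a) ^ (-1 / a) := by
    have h1 : ContinuousAt (fun b : ℝ => (1 + b) ^ p / (1 + p * b)) a :=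
      ContinuousAt.div (ContinuousAt.rpow_const (by fun_prop) (Or.inr (by linarith)))
        (by fun_prop) (by positivity)
    have h2 : ContinuousAt (fun b : ℝ => m * (1 - b / a)) a := by fun_prop
    filter_upwards [nhdsWithin_le_nhds (h1.eventually (lt_mem_nhds hl)),
      nhdsWithin_le_nhds (lt_mem_nhds ha),
      nhdsWithin_le_nhds (h2.eventually (gt_mem_nhds (by simpa [ha.ne'] using hc0)))]
      with b e1 e2 e3 using ⟨e1, e2, e3⟩
  obtain ⟨b, ⟨hbl, hb, hbm⟩, hba⟩ := (hev.and self_mem_nhdsWithin).exists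
  have hba : b < a := hba
  have hpb : 0 < p * b := by positivity
  obtain ⟨κ', hκ1, hκ2⟩ := exists_between (rpow_div_lt_of_lt hp hb hba)
  obtain ⟨K, hK1, hK2⟩ := exists_between hκ2
  have hone : 1 ≤ (1 + b) ^ p / (1 + p * b) := by
    rw [one_le_div (by positivity)]
    exact one_add_mul_self_le_rpow_one_add (by linarith) hp.le
  have hd : 0 < 1 - b / a := sub_pos.2 ((div_lt_one ha).2 hba)
  have hev : ∀ᶠ θ in nhdsWithin (0 : ℝ) (Ioi 0), θ * (1 + p * b) < 1 ∧
      (1 + b) ^ p * (1 + p * b * θ) < κ' * (1 + p * b) ∧ κ' < K * (1 - b * θ) ^ p ∧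
      l < (1 + b - b * θ) ^ p / (1 + p * b) ∧
      m < (1 + a) ^ (-1 / a) / (1 - b / a + b / a * θ) := by
    have c1 : ContinuousAt (fun θ : ℝ => θ * (1 + p * b)) 0 := by fun_prop
    have c2 : ContinuousAt (fun θ : ℝ => (1 + b) ^ p * (1 + p * b * θ)) 0 := by fun_prop
    have c3 : ContinuousAt (fun θ : ℝ => K * (1 - b * θ) ^ p) 0 :=
      continuousAt_const.mul (ContinuousAt.rpow_const (by fun_prop) (Or.inr (by linarith)))
    have c4 : ContinuousAt (fun θ : ℝ => (1 + b - b * θ) ^ p / (1 + p * b)) 0 :=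
      (ContinuousAt.rpow_const (by fun_prop) (Or.inr (by linarith))).div_const _
    have c5 : ContinuousAt (fun θ : ℝ => (1 + a) ^ (-1 / a) / (1 - b / a + b / a * θ)) 0 :=
      continuousAt_const.div (by fun_prop) (by simpa using hd.ne')
    filter_upwards [nhdsWithin_le_nhds (c1.eventually (gt_mem_nhds (a := 1) (by simp))),
      nhdsWithin_le_nhds (c2.eventually (gt_mem_nhds (a := κ' * (1 + p * b))
        (by simpa using (div_lt_iff₀ (by positivity)).1 hκ1))),
      nhdsWithin_le_nhds (c3.eventually (lt_mem_nhds (a := κ') (by simpa using hK1))),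
      nhdsWithin_le_nhds (c4.eventually (lt_mem_nhds (a := l) (by simpa using hbl))),
      nhdsWithin_le_nhds (c5.eventually (lt_mem_nhds (a := m)
        (by simpa using (lt_div_iff₀ hd).2 hbm)))]
      with θ e1 e2 e3 e4 e5 using ⟨e1, e2, e3, e4, e5⟩
  obtain ⟨θ, ⟨h1, h2, h3, h4, h5⟩, hθ⟩ := (hev.and self_mem_nhdsWithin).exists
  obtain ⟨κ, z, e1, e2, e3, e4⟩ := exists_realizable_of_params hp ha hb hba hθ h1
    (by linarith : 1 ≤ K) (by linarith : 1 ≤ κ') h2.le h3.le h4 h5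
  exact ⟨K, κ, z, hK2, by linarith, e2, e3, e4⟩

lemma IsPiece.congr {p e K η u v : ℝ} {X : Fin 3 → ℝ} {W w : ℝ → ℝ} (hW : IsPiece p e K η u v X W)
    (h : ∀ r ∈ Ico u v, w r = W r) : IsPiece p e K η u v X w := by
  have key : ∀ (f : ℝ → ℝ) (s t : ℝ), u ≤ s → s ≤ t → t ≤ v →
      ∫ r in s..t, f (w r) = ∫ r in s..t, f (W r) := by
    intro f s t hs hst ht
    refine intervalIntegral.integral_congr_ae ?_
    filter_upwards [compl_mem_ae_iff.2 (measure_singleton v)] with r hr hr'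
    rw [uIoc_of_le hst] at hr'
    rw [h r ⟨hs.trans hr'.1.le, lt_of_le_of_ne (hr'.2.trans ht) hr⟩]
  refine ⟨fun j s hs => ?_, fun s t hs hst ht => ?_⟩
  · rw [key (fun x => x ^ momentExp p e j - X j) u s le_rfl hs.1 hs.2]
    exact hW.dev j s hs
  · have := hW.rh s t hs hst ht
    unfold RevHolderOn at this ⊢
    rwa [key (fun x => x ^ p) s t hs hst.le ht, key (fun x => x) s t hs hst.le ht]

/-- The integral of `w ^ p - C (1 + p (w - 1))` over an interval sharing an endpoint with the
domain of a piece `w` is nonpositive. -/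
lemma IsPiece.integral_nonpos {p e K η u v C κ z : ℝ} {w : ℝ → ℝ}
    (hw : IsPiece p e K η u v ![1, κ, z] w) (hp : 0 ≤ p) (hC : 0 ≤ C)
    (hI : ∀ s t, IntervalIntegrable w volume s t)
    (hIp : ∀ s t, IntervalIntegrable (fun r => w r ^ p) volume s t) (hη : 0 ≤ η)
    (h : κ + η ≤ C * (1 - p * η)) {s : ℝ} (hs : s ∈ Icc u v) :
    (∫ r in u..s, (w r ^ p - C * (1 + p * (w r - 1)))) ≤ 0 ∧
      (∫ r in s..v, (w r ^ p - C * (1 + p * (w r - 1)))) ≤ 0 := by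
  have hv : v ∈ Icc u v := ⟨hs.1.trans hs.2, le_rfl⟩
  have split : ∀ a b : ℝ, (∫ r in a..b, (w r ^ p - C * (1 + p * (w r - 1)))) =
      (∫ r in a..b, (w r ^ p - κ)) - p * C * (∫ r in a..b, (w r - 1)) + (κ - C) * (b - a) := by
    intro a b
    rw [← intervalIntegral.integral_const_mul, ← intervalIntegral.integral_sub
      ((hIp a b).sub intervalIntegrable_const) (((hI a b).sub intervalIntegrable_const).const_mul _),
      show (κ - C) * (b - a) = ∫ _ in a..b, (κ - C) by simp; ring,
      ← intervalIntegral.integral_add _ intervalIntegrable_const]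
    · congr 1
      funext r
      ring
    · exact ((hIp a b).sub intervalIntegrable_const).sub
        (((hI a b).sub intervalIntegrable_const).const_mul _)
  have d0 := fun s hs => hw.dev 0 s hs
  have d1 := fun s hs => hw.dev 1 s hs
  simp only [momentExp, Matrix.cons_val_zero, Matrix.cons_val_one, Real.rpow_one] at d0 d1
  have a0 := intervalIntegral.integral_add_adjacent_intervals
    ((hI u s).sub (intervalIntegrable_const (c := 1))) ((hI s v).sub intervalIntegrable_const)
  have a1 := intervalIntegral.integral_add_adjacent_intervals
    ((hIp u s).sub (intervalIntegrable_const (c := κ))) ((hIp s v).sub intervalIntegrable_const)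
  have z0 := d0 v hv
  have z1 := d1 v hv
  rw [sub_self, min_eq_right (sub_nonneg.2 hv.1), mul_zero, abs_nonpos_iff] at z0 z1
  have e0 := abs_le.1 (d0 s hs)
  have e1 := abs_le.1 (d1 s hs)
  have hpC : 0 ≤ p * C := mul_nonneg hp hC
  have m1 := mul_le_mul_of_nonneg_left (min_le_left (s - u) (v - s)) hη
  have m2 := mul_le_mul_of_nonneg_left (min_le_right (s - u) (v - s)) hη
  have hu : 0 ≤ s - u := sub_nonneg.2 hs.1
  have hv' : 0 ≤ v - s := sub_nonneg.2 hs.2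
  rw [split, split]
  rw [z0] at a0
  rw [z1] at a1
  have f1 := mul_le_mul_of_nonneg_left e0.1 hpC
  have f2 := mul_le_mul_of_nonneg_left e0.2 hpC
  have g1 := mul_le_mul_of_nonneg_left m1 hpC
  have g2 := mul_le_mul_of_nonneg_left m2 hpC
  have k1 := mul_le_mul_of_nonneg_right h hu
  have k2 := mul_le_mul_of_nonneg_right h hv'
  constructor
  · linarith
  · have b0 : (∫ r in s..v, (w r - 1)) = -∫ r in u..s, (w r - 1) := by linarith
    have b1 : (∫ r in s..v, (w r ^ p - κ)) = -∫ r in u..s, (w r ^ p - κ) := by linarith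
    rw [b0, b1]
    linarith

lemma integral_nonpos_of_cells {f : ℝ → ℝ} (hf : ∀ s t, IntervalIntegrable f volume s t)
    (h : ∀ (i : ℤ), ∀ s ∈ Icc (i : ℝ) (i + 1), (∫ r in (i : ℝ)..s, f r) ≤ 0 ∧
      (∫ r in s..(i + 1 : ℝ), f r) ≤ 0) {s t : ℝ} (hst : ⌊s⌋ + 1 ≤ ⌊t⌋) :
    (∫ r in s..t, f r) ≤ 0 := by
  have hF : Antitone fun i : ℤ => ∫ r in (0 : ℝ)..i, f r := by
    refine antitone_int_of_succ_le fun i => ?_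
    have h1 := intervalIntegral.integral_add_adjacent_intervals (hf 0 i) (hf i (i + 1))
    have h2 := (h i (i + 1) ⟨by linarith, le_rfl⟩).1
    push_cast
    linarith
  have h1 := (h ⌊s⌋ s ⟨Int.floor_le s, (Int.lt_floor_add_one s).le⟩).2
  have h2 := (h ⌊t⌋ t ⟨Int.floor_le t, (Int.lt_floor_add_one t).le⟩).1
  have h3 := hF hst
  have h4 := intervalIntegral.integral_add_adjacent_intervals (hf 0 (⌊s⌋ + 1)) (hf (⌊s⌋ + 1) ⌊t⌋)
  have h5 := intervalIntegral.integral_add_adjacent_intervals (hf s (⌊s⌋ + 1)) (hf (⌊s⌋ + 1) ⌊t⌋)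
  have h6 := intervalIntegral.integral_add_adjacent_intervals (hf s ⌊t⌋) (hf ⌊t⌋ t)
  push_cast at h3
  linarith

lemma revHolderOn_of_integral_nonpos {p C s t : ℝ} {w : ℝ → ℝ} (hp : 1 ≤ p) (hC : 0 ≤ C)
    (hst : s < t) (hw : ∀ r, 0 ≤ w r) (hI : IntervalIntegrable w volume s t)
    (hIp : IntervalIntegrable (fun r => w r ^ p) volume s t)
    (h : (∫ r in s..t, (w r ^ p - C * (1 + p * (w r - 1)))) ≤ 0) : RevHolderOn p C w s t := by
  have hts : 0 < t - s := sub_pos.2 hst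
  rw [intervalIntegral.integral_sub hIp (((intervalIntegrable_const (c := (1 : ℝ))).add
    ((hI.sub intervalIntegrable_const).const_mul p)).const_mul C),
    intervalIntegral.integral_const_mul, intervalIntegral.integral_add intervalIntegrable_const
    ((hI.sub intervalIntegrable_const).const_mul p), intervalIntegral.integral_const_mul,
    intervalIntegral.integral_sub hI intervalIntegrable_const] at h
  simp only [intervalIntegral.integral_const, smul_eq_mul, mul_one] at h
  have h0 : 0 ≤ (∫ r in s..t, w r) / (t - s) :=
    div_nonneg (intervalIntegral.integral_nonneg hst.le fun r _ => hw r) hts.le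
  have h1 := one_add_mul_self_le_rpow_one_add
    (by linarith : -1 ≤ (∫ r in s..t, w r) / (t - s) - 1) hp
  rw [add_sub_cancel] at h1
  refine le_trans ?_ (mul_le_mul_of_nonneg_left h1 hC)
  rw [div_le_iff₀ hts]
  have h2 : C * (1 + p * ((∫ r in s..t, w r) / (t - s) - 1)) * (t - s) =
      C * ((t - s) + p * ((∫ r in s..t, w r) - (t - s))) := by
    field_simp
  linarith

/-- A bounded weight whose restrictions to the cells `[i,i+1]` are pieces with reverse Hölder
constant that of `x ^ a`, and which approach the extremal moments far away. -/
lemma exists_weight {p a : ℝ} (hp : 1 < p) (ha : 0 < a) :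
    ∃ (w : ℝ → ℝ) (η κ z : ℤ → ℝ), Measurable w ∧ (∀ t, 0 < w t ∧ w t ≤ 1 + a) ∧ ∀ i : ℤ,
      0 < η i ∧ κ i + η i ≤ (1 + a) ^ p / (1 + p * a) * (1 - p * η i) ∧
      (1 + a) ^ p / (1 + p * a) - 1 / (i.natAbs + 1) < κ i ∧ i.natAbs < z i ∧
      IsPiece p (-1 / a) ((1 + a) ^ p / (1 + p * a)) (η i) i (i + 1) ![1, κ i, z i] w := by
  set C := (1 + a) ^ p / (1 + p * a) with hC
  have hcell : ∀ i : ℤ, ∃ (W : ℝ → ℝ) (η κ z : ℝ), Measurable W ∧ (∀ t, 0 < W t ∧ W t ≤ 1 + a) ∧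
      0 < η ∧ κ + η ≤ C * (1 - p * η) ∧ C - 1 / (i.natAbs + 1) < κ ∧ i.natAbs < z ∧
      IsPiece p (-1 / a) C η i (i + 1) ![1, κ, z] W := by
    intro i
    obtain ⟨K, κ, z, hK, hκ, hl, hz, c, hc, hR⟩ := exists_realizable
      (l := C - 1 / (i.natAbs + 1)) (m := i.natAbs) hp ha (sub_lt_self _ (by positivity))
    have hev : ∀ᶠ η in nhdsWithin (0 : ℝ) (Ioi 0), κ + η - C * (1 - p * η) < 0 := by
      have h1 : ContinuousAt (fun η : ℝ => κ + η - C * (1 - p * η)) 0 := by fun_prop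
      exact nhdsWithin_le_nhds (h1.eventually (gt_mem_nhds (a := 0) (by simpa using hκ)))
    obtain ⟨η, h1, h2⟩ := (hev.and self_mem_nhdsWithin).exists
    obtain ⟨W, hWm, hWb, hW⟩ := hR C hK η h2 i (i + 1) (by linarith)
    exact ⟨W, η, κ, z, hWm, fun t => ⟨hc.trans_le (hWb t).1, (hWb t).2⟩, h2, by linarith, hl, hz,
      hW⟩
  choose W η κ z hWm hWb h0 h1 h2 h3 hW using hcell
  refine ⟨fun t => W ⌊t⌋ t, η, κ, z, ?_, fun t => hWb _ t, fun i => ⟨h0 i, h1 i, h2 i, h3 i,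
    (hW i).congr fun r hr => ?_⟩⟩
  · have hm : Measurable fun q : ℝ × ℤ => W q.2 q.1 :=
      measurable_from_prod_countable_left fun i => hWm i
    exact hm.comp (measurable_id.prodMk Int.measurable_floor)
  · rw [Int.floor_eq_iff.2 ⟨hr.1, hr.2⟩]

lemma intAvg_eq {a b : ℝ} (hab : a < b) (f : ℝ → ℝ) :
    intAvg a b f = (∫ r in a..b, f r) / (b - a) := by
  rw [intAvg, setAverage_eq, intervalIntegral.integral_of_le hab.le, integral_Ioc_eq_integral_Ioo,
    smul_eq_mul, div_eq_inv_mul]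
  simp [Measure.real, hab.le]

lemma IsPiece.integral_eq {p e K η u v : ℝ} {X : Fin 3 → ℝ} {w : ℝ → ℝ}
    (hw : IsPiece p e K η u v X w) (huv : u ≤ v) (j : Fin 3)
    (hI : IntervalIntegrable (fun r => w r ^ momentExp p e j) volume u v) :
    ∫ r in u..v, w r ^ momentExp p e j = (v - u) * X j := by
  have h := hw.dev j v ⟨huv, le_rfl⟩
  rw [sub_self, min_eq_right (sub_nonneg.2 huv), mul_zero, abs_nonpos_iff,
    intervalIntegral.integral_sub hI intervalIntegrable_const, sub_eq_zero] at h
  simpa using h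

/-- Sharpness of the range `q > 1 - s⁻_p(Q)` in `RH_p ⊂ A_q` on the real
line: there is a weight with `[w]_{RH_p} = Q` and `[w]_{q₀} = ∞` for `q₀ = 1 - s⁻_p(Q)`. -/
theorem RHp_to_Aq_sharpness
    (p Q : ℝ) (hp : 1 < p) (hQ : 1 < Q)
    (sm : ℝ) (hsm_mem : sm ∈ Iic (0:ℝ))
    (hsm : (1 - p * sm) ^ (1 / p) * (1 - sm)⁻¹ = 1 / Q)
    (q₀ : ℝ) (hq₀ : q₀ = 1 - sm) :
    ∃ w : ℝ → ℝ, Measurable w ∧ (∀ᵐ x ∂(volume : Measure ℝ), 0 < w x) ∧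
      MemRH w p Q ∧
      (∀ Q' : ℝ, Q' < Q → ∃ a b : ℝ, a < b ∧ Q' < RHChar w p a b) ∧
      ¬ ∃ C : ℝ, MemAp w q₀ C := by
  have hp0 : 0 < p := by linarith
  have hQ0 : 0 < Q := by linarith
  obtain ⟨a, rfl⟩ : ∃ a, sm = -a := ⟨-sm, by ring⟩
  have ha : 0 < a := by
    refine lt_of_le_of_ne (by simpa using hsm_mem) fun h => ?_
    subst h
    simp only [neg_zero, mul_zero, sub_zero, Real.one_rpow, inv_one, mul_one] at hsm
    rw [eq_div_iff hQ0.ne'] at hsm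
    linarith
  obtain rfl : q₀ = 1 + a := by rw [hq₀]; ring
  have hpa : 0 < p * a := by positivity
  have hC : (1 + a) ^ p / (1 + p * a) = Q ^ p := by
    rw [mul_neg, sub_neg_eq_add, sub_neg_eq_add] at hsm
    have h1 : Q = (1 + a) / (1 + p * a) ^ (1 / p) := by
      field_simp at hsm ⊢
      linarith
    rw [h1, Real.div_rpow (by positivity) (by positivity), one_div,
      Real.rpow_inv_rpow (by positivity) hp0.ne']
  obtain ⟨w, η, κ, z, hwm, hwb, hcell⟩ := exists_weight hp ha
  rw [hC] at hcell
  have hI : ∀ s t, IntervalIntegrable w volume s t :=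
    intervalIntegrable_of_bound hwm fun t => by rw [abs_of_pos (hwb t).1]; exact (hwb t).2
  have hIp : ∀ s t, IntervalIntegrable (fun r => w r ^ p) volume s t :=
    intervalIntegrable_of_bound (hwm.pow_const p) (M := (1 + a) ^ p) fun t => by
      rw [abs_of_pos (Real.rpow_pos_of_pos (hwb t).1 p)]
      exact Real.rpow_le_rpow (hwb t).1.le (hwb t).2 hp0.le
  have hQp : 0 < Q ^ p := by positivity
  have hrev : ∀ s t, s < t → RevHolderOn p (Q ^ p) w s t := by
    intro s t hst
    rcases le_or_gt t (⌊s⌋ + 1) with h | h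
    · obtain ⟨-, -, -, -, h5⟩ := hcell ⌊s⌋
      exact h5.rh s t (Int.floor_le s) hst h
    · refine revHolderOn_of_integral_nonpos hp.le hQp.le hst (fun r => (hwb r).1.le) (hI s t)
        (hIp s t) (integral_nonpos_of_cells (fun s t => ?_) (fun i s hs => ?_)
        (Int.le_floor.2 (by push_cast; exact h.le)))
      · exact (hIp s t).sub ((intervalIntegrable_const.add
          (((hI s t).sub intervalIntegrable_const).const_mul p)).const_mul _)
      · obtain ⟨h1, h2, -, -, h5⟩ := hcell i
        exact h5.integral_nonpos hp0.le hQp.le hI hIp h1.le h2 hs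
  have havg : ∀ i : ℤ, intAvg i (i + 1) w = 1 := by
    intro i
    have h := (hcell i).2.2.2.2.integral_eq (by linarith) 0 (by simpa [momentExp] using hI _ _)
    rw [intAvg_eq (by linarith)]
    simpa [momentExp] using h
  refine ⟨w, hwm, ae_of_all _ fun t => (hwb t).1, fun s t hst => ⟨?_, ?_, ?_⟩, fun Q' hQ' => ?_, ?_⟩
  · exact (intervalIntegrable_iff_integrableOn_Ioo_of_le hst.le).1 (hI s t)
  · exact (intervalIntegrable_iff_integrableOn_Ioo_of_le hst.le).1 (hIp s t)
  · have h := hrev s t hst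
    have hts : 0 < t - s := sub_pos.2 hst
    rw [RHChar, intAvg_eq hst, intAvg_eq hst]
    have hX : 0 < (∫ r in s..t, w r) / (t - s) :=
      div_pos (intervalIntegral.intervalIntegral_pos_of_pos (hI s t) (fun r => (hwb r).1) hst) hts
    have hY : 0 ≤ (∫ r in s..t, w r ^ p) / (t - s) :=
      div_nonneg (intervalIntegral.integral_nonneg hst.le
        fun r _ => Real.rpow_nonneg (hwb r).1.le p) hts.le
    rw [← div_eq_mul_inv, div_le_iff₀ hX]
    calc _ ≤ (Q ^ p * ((∫ r in s..t, w r) / (t - s)) ^ p) ^ (1 / p) :=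
          Real.rpow_le_rpow hY h (by positivity)
      _ = _ := by
        rw [← Real.mul_rpow hQ0.le hX.le, one_div,
          Real.rpow_rpow_inv (mul_pos hQ0 hX).le hp0.ne']
  · have hQ1 : max Q' 0 ^ p < Q ^ p :=
      Real.rpow_lt_rpow (le_max_right _ _) (max_lt hQ' hQ0) hp0
    obtain ⟨n, hn⟩ := exists_nat_one_div_lt (sub_pos.2 hQ1)
    obtain ⟨-, -, h3, -, h5⟩ := hcell n
    refine ⟨n, n + 1, by linarith, ?_⟩
    have h1 := havg n
    have h2 := h5.integral_eq (by linarith) 1 (by simpa [momentExp] using hIp _ _)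
    simp only [momentExp, Matrix.cons_val_one, Int.cast_natCast, add_sub_cancel_left, one_mul,
      Matrix.cons_val_zero] at h1 h2
    simp only [Int.natAbs_natCast] at h3
    rw [RHChar, h1, intAvg_eq (by linarith), h2, add_sub_cancel_left, div_one, inv_one, mul_one]
    calc Q' ≤ max Q' 0 := le_max_left _ _
      _ = (max Q' 0 ^ p) ^ (1 / p) := by
        rw [one_div, Real.rpow_rpow_inv (le_max_right _ _) hp0.ne']
      _ < _ := Real.rpow_lt_rpow (Real.rpow_nonneg (le_max_right _ _) p) (by linarith)
        (by positivity)
  · rintro ⟨M, hM⟩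
    obtain ⟨n, hn⟩ := (((tendsto_rpow_atTop ha).comp tendsto_natCast_atTop_atTop).eventually
      (eventually_gt_atTop M)).exists
    obtain ⟨-, -, -, h4, h5⟩ := hcell n
    obtain ⟨-, h6, h7⟩ := hM n (n + 1) (by linarith)
    have h1 := havg n
    simp only [Int.cast_natCast, Int.natAbs_natCast] at h1 h4 h5
    have h2 := h5.integral_eq (by linarith) 2 (by
      simpa [momentExp] using
        (intervalIntegrable_iff_integrableOn_Ioo_of_le (by linarith : (n : ℝ) ≤ n + 1)).2 h6)
    have h3 : (∫ r in (n : ℝ)..(n + 1), w r ^ (-1 / a)) = z n := by simpa [momentExp] using h2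
    rw [ApChar, h1, add_sub_cancel_left, intAvg_eq (by linarith), h3, add_sub_cancel_left, div_one,
      one_mul] at h7
    have h8 := Real.rpow_le_rpow (Nat.cast_nonneg n) h4.le ha.le
    exact absurd (hn.trans_le h8) (not_lt.2 h7)
end
end

section
/- (Vasyunin's Bellman function for A_p.) Fix p > 1, set p1 = -1/(p-1), fix Q > 1, and fix r ∈ (1/s⁻_{p1}(Q), p1] ∪ [1, 1/s⁺_{p1}(Q)). Then there exists a nonnegative function B_Q defined on the domain Ω_Q := {x = (x₁, x₂) ∈ ℝ² : x₁ > 0, x₂ > 0, 1 ≤ x₁ · x₂^{p-1} ≤ Q} such that: (i) B_Q is continuous on Ω_Q; (ii) B_Q is concave along line segments contained in Ω_Q, i.e. for every segment [x⁻, x⁺] ⊂ Ω_Q and every λ ∈ [0,1], B_Q(λx⁻ + (1-λ)x⁺) ≥ λ B_Q(x⁻) + (1-λ) B_Q(x⁺); (iii) B_Q(x₁, x₁^{p1}) = x₁^r for every x₁ > 0; (iv) there is a finite constant c(r,Q) > 0 with B_Q(x) ≤ c(r,Q) · x₁^r for every x ∈ Ω_Q. -/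
open Set Filter

noncomputable section

/-- The function `σ ↦ (1 - σ) (1 + σ / k) ^ k` is strictly decreasing on `[0, 1)`. -/
lemma tangentProduct_lt {k a b : ℝ} (hk : 0 < k) (ha : 0 ≤ a) (hab : a < b) (hb : b < 1) :
    (1 - b) * (1 + b / k) ^ k < (1 - a) * (1 + a / k) ^ k := by
  have hA : 0 < 1 + a / k := by positivity
  have hB : 0 < 1 + b / k := by have : 0 < b := by linarith
                                positivity
  have ha1 : 0 < 1 - a := by linarith
  have hb1 : 0 < 1 - b := by linarith
  have h1 : 0 < (1 - a) * (1 + a / k) ^ k := by positivity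
  have h2 : 0 < (1 - b) * (1 + b / k) ^ k := by positivity
  rw [← Real.log_lt_log_iff h2 h1, Real.log_mul hb1.ne' (by positivity),
    Real.log_mul ha1.ne' (by positivity), Real.log_rpow hA, Real.log_rpow hB]
  have e1 : Real.log ((1 - b) / (1 - a)) < (1 - b) / (1 - a) - 1 := by
    apply Real.log_lt_sub_one_of_pos (by positivity)
    rw [Ne, div_eq_one_iff_eq ha1.ne']; linarith
  have e2 : Real.log ((1 + b / k) / (1 + a / k)) ≤ (1 + b / k) / (1 + a / k) - 1 :=
    Real.log_le_sub_one_of_pos (by positivity)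
  rw [Real.log_div hb1.ne' ha1.ne'] at e1
  rw [Real.log_div hB.ne' hA.ne'] at e2
  have e3 : k * ((1 + b / k) / (1 + a / k) - 1) ≤ b - a := by
    have : k * ((1 + b / k) / (1 + a / k) - 1) = (b - a) / (1 + a / k) := by field_simp; ring
    rw [this]
    apply div_le_self (by linarith)
    have : 0 ≤ a / k := by positivity
    linarith
  have e4 : (1 - b) / (1 - a) - 1 ≤ -(b - a) := by
    have : (1 - b) / (1 - a) - 1 = -((b - a) / (1 - a)) := by field_simp; ring
    rw [this]
    apply neg_le_neg
    rw [le_div_iff₀ ha1]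
    nlinarith
  have e5 := mul_le_mul_of_nonneg_left e2 hk.le
  linarith

/-- Convexity of the function measuring the position of a point relative to the tangent lines. -/
lemma convexOn_tangentDefect {k τ : ℝ} (hk : 0 < k) (hτ : 0 ≤ τ) :
    ConvexOn ℝ (Ici (0 : ℝ)) (fun x => (1 - τ) - (1 + k) * x + (k + τ) * x ^ (1 + 1 / k)) := by
  have hkinv : 0 < 1 / k := by positivity
  have h1 := (convexOn_rpow (p := 1 + 1 / k) (by linarith)).smul (c := k + τ) (by linarith)
  have h2 : ConvexOn ℝ (Ici (0 : ℝ)) (fun x => (1 - τ) - (1 + k) * x) := by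
    refine ⟨convex_Ici 0, ?_⟩
    intro x _ y _ a b _ _ hab
    simp only [smul_eq_mul]
    have : b = 1 - a := by linarith
    subst this
    apply le_of_eq; ring
  exact h2.add h1

/-- Monotonicity of the tangent envelope in the ratio `ρ` of the abscissas of tangency. -/
lemma envelope_le {k r τ ρ : ℝ} (hk : 0 < k) (hr : 1 ≤ r) (hτ : 0 ≤ τ) (hρ : 0 < ρ)
    (h : 1 ≤ ρ ∨ (1 - τ) - (1 + k) * ρ + (k + τ) * ρ ^ (1 + 1 / k) ≤ 0) :
    1 - r * τ ≤ (1 - r) * (1 + k * r) * ρ ^ r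
      + r * (1 + k * r) / (1 + k) * (1 - τ) * ρ ^ (r - 1)
      + k ^ 2 * r * (r - 1) / (1 + k) * (1 + τ / k) * ρ ^ (r + 1 / k) := by
  set G : ℝ → ℝ := fun x => (1 - r) * (1 + k * r) * x ^ r
      + r * (1 + k * r) / (1 + k) * (1 - τ) * x ^ (r - 1)
      + k ^ 2 * r * (r - 1) / (1 + k) * (1 + τ / k) * x ^ (r + 1 / k) with hG
  set E : ℝ → ℝ := fun x => (1 - τ) - (1 + k) * x + (k + τ) * x ^ (1 + 1 / k) with hE
  have hk1 : 0 < 1 + k := by linarith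
  have hkinv : 0 < 1 / k := by positivity
  have hG1 : G 1 = 1 - r * τ := by
    simp only [hG, Real.one_rpow]; field_simp; ring
  have hE1 : E 1 = 0 := by simp only [hE, Real.one_rpow]; ring
  have hd : ∀ x, 0 < x →
      HasDerivAt G (r * (r - 1) * (1 + k * r) / (1 + k) * x ^ (r - 2) * E x) x := by
    intro x hx
    have d (q : ℝ) := Real.hasDerivAt_rpow_const (x := x) (p := q) (Or.inl hx.ne')
    have := (((d r).const_mul ((1 - r) * (1 + k * r))).add
      ((d (r - 1)).const_mul (r * (1 + k * r) / (1 + k) * (1 - τ)))).add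
      ((d (r + 1 / k)).const_mul (k ^ 2 * r * (r - 1) / (1 + k) * (1 + τ / k)))
    refine this.congr_deriv ?_
    have p1 : x ^ (r - 1) = x ^ (r - 2) * x := by
      rw [← Real.rpow_add_one hx.ne']; congr 1; ring
    have p2 : x ^ (r - 1 - 1) = x ^ (r - 2) := by congr 1; ring
    have p3 : x ^ (r + 1 / k - 1) = x ^ (r - 2) * x ^ (1 + 1 / k) := by
      rw [← Real.rpow_add hx]; congr 1; ring
    simp only [hE]
    rw [p1, p2, p3]
    generalize x ^ (1 + 1 / k) = y
    generalize x ^ (r - 2) = u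
    field_simp
    ring
  have hC : 0 ≤ r * (r - 1) * (1 + k * r) / (1 + k) := by
    have : 0 ≤ r - 1 := by linarith
    positivity
  have hconv : ConvexOn ℝ (Ici (0 : ℝ)) E := convexOn_tangentDefect hk hτ
  rw [← hG1]
  change G 1 ≤ G ρ
  rcases le_total 1 ρ with h1 | h1
  · have hm : MonotoneOn G (Icc 1 ρ) := by
      apply monotoneOn_of_deriv_nonneg (convex_Icc _ _)
      · intro x hx
        exact (hd x (by linarith [hx.1])).continuousAt.continuousWithinAt
      · intro x hx
        rw [interior_Icc] at hx
        exact (hd x (by linarith [hx.1])).differentiableAt.differentiableWithinAt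
      · intro x hx
        rw [interior_Icc] at hx
        have hx0 : 0 < x := by linarith [hx.1]
        rw [(hd x hx0).deriv]
        refine mul_nonneg (mul_nonneg hC (by positivity)) ?_
        have hb := one_add_mul_self_le_rpow_one_add (s := x - 1) (by linarith)
          (p := 1 + 1 / k) (by linarith)
        rw [add_sub_cancel] at hb
        have hb' := mul_le_mul_of_nonneg_left hb (show 0 ≤ k + τ by linarith)
        have : (k + τ) * (1 + (1 + 1 / k) * (x - 1))
            = (k + τ) + (1 + k) * (x - 1) + τ * (1 + 1 / k) * (x - 1) := by
          field_simp; ring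
        have h3 : 0 ≤ τ * (1 + 1 / k) * (x - 1) :=
          mul_nonneg (by positivity) (by linarith [hx.1])
        simp only [hE]
        linarith
    exact hm (left_mem_Icc.2 h1) (right_mem_Icc.2 h1) h1
  · have hEρ : E ρ ≤ 0 := by
      rcases h with h | h
      · have : ρ = 1 := le_antisymm h1 h
        rw [this, hE1]
      · exact h
    have hm : AntitoneOn G (Icc ρ 1) := by
      apply antitoneOn_of_deriv_nonpos (convex_Icc _ _)
      · intro x hx
        exact (hd x (by linarith [hx.1])).continuousAt.continuousWithinAt
      · intro x hx
        rw [interior_Icc] at hx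
        exact (hd x (by linarith [hx.1])).differentiableAt.differentiableWithinAt
      · intro x hx
        rw [interior_Icc] at hx
        have hx0 : 0 < x := by linarith [hx.1]
        rw [(hd x hx0).deriv]
        refine mul_nonpos_of_nonneg_of_nonpos (mul_nonneg hC (by positivity)) ?_
        have := hconv.le_max_of_mem_Icc (x := ρ) (y := 1) (z := x) hρ.le
          (mem_Ici.2 zero_le_one) ⟨hx.1.le, hx.2.le⟩
        rw [hE1, max_eq_right hEρ] at this
        exact this
    exact hm (left_mem_Icc.2 h1) (right_mem_Icc.2 h1) h1

/-- The affine function attached to the tangent line at `(v, w)` dominates the one attached to the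
tangent line at `(v', w')`, at the points of the latter with parameter `τ`. -/
lemma tangent_dominates {k r τ v w v' w' : ℝ} (hk : 0 < k) (hr : 1 ≤ r) (hτ : 0 ≤ τ) (hτ1 : τ < 1)
    (hv : 0 < v) (hw : 0 < w) (hv' : 0 < v') (hw' : 0 < w') (heq : v * w ^ k = v' * w' ^ k)
    (h : v' * (1 - τ) ≤ v ∨
      (v' * (1 - τ) / v - 1) + k * (w' * (1 + τ / k) / w - 1) ≤ 0) :
    v' ^ r * (1 - r * τ) ≤ v ^ r * (1 + r * (1 + k * r) / (1 + k) * (v' * (1 - τ) / v - 1)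
      + k ^ 2 * r * (r - 1) / (1 + k) * (w' * (1 + τ / k) / w - 1)) := by
  obtain ⟨ρ, hρ⟩ : ∃ ρ, ρ = v / v' := ⟨_, rfl⟩
  have hρ0 : 0 < ρ := by rw [hρ]; positivity
  have hvρ : v = v' * ρ := by rw [hρ]; field_simp
  have hk1 : 0 < 1 + k := by linarith
  have hkinv : 0 < 1 / k := by positivity
  have hww : w' / w = ρ ^ (1 / k) := by
    have : ρ = (w' / w) ^ k := by
      rw [Real.div_rpow hw'.le hw.le, hρ]
      field_simp
      linarith
    rw [this, ← Real.rpow_mul (by positivity), mul_one_div_cancel hk.ne', Real.rpow_one]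
  have e1 : v' * (1 - τ) / v = (1 - τ) / ρ := by rw [hvρ]; field_simp
  have e2 : w' * (1 + τ / k) / w = (1 + τ / k) * ρ ^ (1 / k) := by rw [← hww]; ring
  rw [e1, e2] at h ⊢
  have hprod : (1 + τ / k) * (1 - τ) ^ (1 / k) ≤ 1 := by
    have h1 : (1 - τ) * (1 + τ / k) ^ k ≤ 1 := by
      rcases hτ.eq_or_lt with h0 | h0
      · simp [← h0]
      · simpa using (tangentProduct_lt hk le_rfl h0 hτ1).le
    have h2 := Real.rpow_le_one (mul_nonneg (by linarith) (by positivity)) h1 hkinv.le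
    rwa [Real.mul_rpow (by linarith) (by positivity), ← Real.rpow_mul (by positivity),
      mul_one_div_cancel hk.ne', Real.rpow_one, mul_comm] at h2
  have hp (y : ℝ) (hy : 0 < y) : y ^ (1 + 1 / k) = y * y ^ (1 / k) := by
    rw [Real.rpow_add hy, Real.rpow_one]
  have key : 1 ≤ ρ ∨ (1 - τ) - (1 + k) * ρ + (k + τ) * ρ ^ (1 + 1 / k) ≤ 0 := by
    rcases le_total 1 ρ with h1 | h1
    · exact Or.inl h1
    right
    rcases h with h | h
    · have hτρ : 1 - τ ≤ ρ := by
        rw [hvρ] at h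
        exact le_of_mul_le_mul_left h hv'
      have := (convexOn_tangentDefect hk hτ).le_max_of_mem_Icc (x := 1 - τ) (y := 1) (z := ρ)
        (mem_Ici.2 (by linarith)) (mem_Ici.2 zero_le_one) ⟨hτρ, h1⟩
      refine this.trans (max_le ?_ ?_)
      · simp only [hp (1 - τ) (by linarith)]
        have : (1 - τ) - (1 + k) * (1 - τ) + (k + τ) * ((1 - τ) * (1 - τ) ^ (1 / k))
            = (1 - τ) * k * ((1 + τ / k) * (1 - τ) ^ (1 / k) - 1) := by
          field_simp; ring
        rw [this]
        exact mul_nonpos_of_nonneg_of_nonpos (mul_nonneg (by linarith) hk.le) (by linarith)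
      · simp only [Real.one_rpow]
        linarith
    · rw [hp ρ hρ0]
      have : (1 - τ) - (1 + k) * ρ + (k + τ) * (ρ * ρ ^ (1 / k))
          = ρ * ((1 - τ) / ρ - 1 + k * ((1 + τ / k) * ρ ^ (1 / k) - 1)) := by
        field_simp; ring
      rw [this]
      exact mul_nonpos_of_nonneg_of_nonpos hρ0.le h
  have main := envelope_le hk hr hτ hρ0 key
  rw [Real.rpow_sub_one hρ0.ne', Real.rpow_add hρ0] at main
  rw [hvρ, Real.mul_rpow hv'.le hρ0.le, mul_assoc]
  refine mul_le_mul_of_nonneg_left (main.trans (le_of_eq ?_)) (by positivity)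
  generalize ρ ^ (1 / k) = y
  generalize ρ ^ r = u
  field_simp
  ring

/-- If a point `z` lies on the tangent line at `(v, w)` to the upper boundary, to the left of the
point of tangency, and `[z, x]` stays below the upper boundary, then `x` is below the tangent line
or to the left of the point of tangency. -/
lemma below_tangent {k Q σ v w : ℝ} {x : ℝ × ℝ} (hk : 0 < k) (hσ : 0 ≤ σ) (hv : 0 < v) (hw : 0 < w)
    (hQ : v * w ^ k = Q) (hx2 : 0 < x.2)
    (hseg : ∀ l ∈ Icc (0 : ℝ) 1, 0 < (1 - l) * (w * (1 + σ / k)) + l * x.2 ∧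
      ((1 - l) * (v * (1 - σ)) + l * x.1) * ((1 - l) * (w * (1 + σ / k)) + l * x.2) ^ k ≤ Q) :
    x.1 ≤ v ∨ (x.1 / v - 1) + k * (x.2 / w - 1) ≤ 0 := by
  rcases le_or_gt x.1 v with h | h
  · exact Or.inl h
  right
  obtain ⟨A, hA⟩ : ∃ A, A = x.1 / v - 1 := ⟨_, rfl⟩
  obtain ⟨B, hB⟩ : ∃ B, B = x.2 / w - 1 := ⟨_, rfl⟩
  have hx1 : x.1 = v * (1 + A) := by rw [hA]; field_simp; ring
  have hx2' : x.2 = w * (1 + B) := by rw [hB]; field_simp; ring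
  have hA0 : 0 < A := by
    rw [hA, sub_pos, lt_div_iff₀ hv]; linarith
  have hB1 : 0 < 1 + B := by
    rw [hx2'] at hx2
    exact pos_of_mul_pos_right hx2 hw.le
  rw [← hA, ← hB]
  rcases hσ.eq_or_lt with h0 | h0
  · subst h0
    have hlin : ∀ l ∈ Ioc (0 : ℝ) 1, A + k * B + l * ((1 + k) * A * B) ≤ 0 := by
      intro l hl
      have h1 : 0 < 1 + l * A := by nlinarith [hl.1]
      have h2 : 0 < 1 + l * B := by nlinarith [hl.1, hl.2]
      have h3 := (hseg l ⟨hl.1.le, hl.2⟩).2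
      have e1 : (1 - l) * (v * (1 - 0)) + l * x.1 = v * (1 + l * A) := by rw [hx1]; ring
      have e2 : (1 - l) * (w * (1 + 0 / k)) + l * x.2 = w * (1 + l * B) := by
        rw [hx2', zero_div]; ring
      rw [e1, e2, Real.mul_rpow hw.le h2.le, ← hQ] at h3
      have h4 : (1 + l * A) * (1 + l * B) ^ k ≤ 1 := by
        have : 0 < v * w ^ k := by positivity
        refine le_of_mul_le_mul_left ?_ this
        linarith
      have h5 := Real.log_nonpos (by positivity) h4
      rw [Real.log_mul h1.ne' (by positivity), Real.log_rpow h2] at h5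
      have h6 := Real.one_sub_inv_le_log_of_pos h1
      have h7 := mul_le_mul_of_nonneg_left (Real.one_sub_inv_le_log_of_pos h2) hk.le
      have h8 : (1 - (1 + l * A)⁻¹) + k * (1 - (1 + l * B)⁻¹) ≤ 0 := by linarith
      have h9 : (1 - (1 + l * A)⁻¹) + k * (1 - (1 + l * B)⁻¹)
          = l / ((1 + l * A) * (1 + l * B)) * (A + k * B + l * ((1 + k) * A * B)) := by
        field_simp; ring
      rw [h9] at h8
      have h10 : 0 < l / ((1 + l * A) * (1 + l * B)) := by
        have := hl.1
        positivity
      by_contra hcon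
      push Not at hcon
      linarith [mul_pos h10 hcon]
    by_contra hcon
    push Not at hcon
    set S := A + k * B
    set D := (1 + k) * A * B
    have hD : 0 ≤ |D| := abs_nonneg D
    have := hlin (S / (2 * (S + |D|))) ⟨by positivity, by
      rw [div_le_one (by positivity)]; linarith⟩
    have h2 : S + S / (2 * (S + |D|)) * D = S * (2 * S + 2 * |D| + D) / (2 * (S + |D|)) := by
      field_simp
    rw [h2] at this
    have h3 : 0 < 2 * S + 2 * |D| + D := by linarith [neg_abs_le D]
    have h4 : 0 < S * (2 * S + 2 * |D| + D) / (2 * (S + |D|)) := by positivity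
    linarith
  · have hs : 0 < σ + A := by linarith
    obtain ⟨l, hl⟩ : ∃ l, l = σ / (σ + A) := ⟨_, rfl⟩
    have hl0 : 0 < l := by rw [hl]; positivity
    have hl1 : l ≤ 1 := by rw [hl, div_le_one hs]; linarith
    have hls : l * (σ + A) = σ := by rw [hl]; field_simp
    have h3 := hseg l ⟨hl0.le, hl1⟩
    have e1 : (1 - l) * (v * (1 - σ)) + l * x.1 = v := by
      rw [hx1]; linear_combination v * hls
    rw [e1, ← hQ] at h3
    have h4 := (Real.rpow_le_rpow_iff h3.1.le hw.le hk).1 (le_of_mul_le_mul_left h3.2 hv)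
    have e2 : (1 - l) * (w * (1 + σ / k)) + l * x.2
        = w + w / k * (l * (A + k * B)) := by
      rw [hx2']
      field_simp
      linear_combination (-1) * hls
    rw [e2] at h4
    have h5 : w / k * (l * (A + k * B)) ≤ 0 := by linarith
    have h6 : 0 < w / k := by positivity
    by_contra hcon
    push Not at hcon
    linarith [mul_pos h6 (mul_pos hl0 hcon)]

/-- The Bellman function in the range `1 ≤ r < 1 / s`. -/
theorem exists_bellman_of_one_le {k Q s r : ℝ} (hk : 0 < k) (hQ : 1 < Q) (hs0 : 0 ≤ s)
    (hs1 : s ≤ 1) (hs : (1 - s) * (1 + s / k) ^ k = 1 / Q) (hr : 1 ≤ r) (hrs : r * s < 1)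
    {Ω : Set (ℝ × ℝ)}
    (hΩ : ∀ x, x ∈ Ω ↔ 0 < x.1 ∧ 0 < x.2 ∧ 1 ≤ x.1 * x.2 ^ k ∧ x.1 * x.2 ^ k ≤ Q) :
    ∃ B : ℝ × ℝ → ℝ,
      (∀ x ∈ Ω, 0 ≤ B x) ∧
      ContinuousOn B Ω ∧
      (∀ x y : ℝ × ℝ, segment ℝ x y ⊆ Ω → ∀ l ∈ Icc (0:ℝ) 1,
        l * B x + (1 - l) * B y ≤ B (l • x + (1 - l) • y)) ∧
      (∀ x ∈ Ω, x.1 * x.2 ^ k = 1 → B x = x.1 ^ r) ∧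
      (∃ c : ℝ, 0 < c ∧ ∀ x ∈ Ω, B x ≤ c * x.1 ^ r) := by
  have hQ0 : 0 < Q := by linarith
  have hs1' : s < 1 := by
    rcases hs1.eq_or_lt with h | h
    · rw [h, sub_self, zero_mul] at hs
      have : 0 < 1 / Q := by positivity
      linarith
    · exact h
  have hcont : ContinuousOn (fun σ : ℝ => (1 - σ) * (1 + σ / k) ^ k) (Icc 0 s) := by
    apply ContinuousOn.mul (by fun_prop)
    exact ContinuousOn.rpow_const (by fun_prop) (fun _ _ => Or.inr hk.le)
  have hinj : InjOn (fun σ : ℝ => (1 - σ) * (1 + σ / k) ^ k) (Icc 0 s) := by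
    have : StrictAntiOn (fun σ : ℝ => (1 - σ) * (1 + σ / k) ^ k) (Icc 0 s) :=
      fun a ha b hb hab => tangentProduct_lt hk ha.1 hab (by linarith [hb.2])
    exact this.injOn
  have hex : ∀ x : ℝ × ℝ, ∃ σ, x ∈ Ω → σ ∈ Icc 0 s ∧
      (1 - σ) * (1 + σ / k) ^ k = x.1 * x.2 ^ k / Q := by
    intro x
    by_cases hx : x ∈ Ω
    · have hx' := (hΩ x).1 hx
      have := intermediate_value_Icc' hs0 hcont
      have hmem : x.1 * x.2 ^ k / Q ∈ Icc ((1 - s) * (1 + s / k) ^ k)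
          ((1 - 0) * (1 + 0 / k) ^ k) := by
        rw [hs]
        constructor
        · gcongr; exact hx'.2.2.1
        · rw [zero_div, add_zero, Real.one_rpow, div_le_iff₀ hQ0]
          linarith [hx'.2.2.2]
      obtain ⟨σ, h1, h2⟩ := this hmem
      exact ⟨σ, fun _ => ⟨h1, h2⟩⟩
    · exact ⟨0, fun h => absurd h hx⟩
  choose σ hσ using hex
  have hσc : ContinuousOn σ Ω := by
    let f : Icc 0 s → ℝ := fun t => (1 - (t : ℝ)) * (1 + (t : ℝ) / k) ^ k
    have hf : Continuous f := continuousOn_iff_continuous_domRestrict.1 hcont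
    have hfi : Function.Injective f := injOn_iff_injective.1 hinj
    have hemb := hf.isClosedEmbedding hfi
    let g : Ω → Icc 0 s := fun x => ⟨σ x, (hσ x x.2).1⟩
    have hg : Continuous g := by
      rw [hemb.isInducing.continuous_iff]
      have : f ∘ g = fun x : Ω => x.1.1 * x.1.2 ^ k / Q := by
        funext x
        exact (hσ x x.2).2
      rw [this]
      apply Continuous.div_const
      apply Continuous.mul (by fun_prop)
      exact Continuous.rpow_const (by fun_prop) (fun _ => Or.inr hk.le)
    rw [continuousOn_iff_continuous_domRestrict]
    exact continuous_subtype_val.comp hg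
  have hM : 0 < (1 - s) ^ r / (1 - r * s) :=
    div_pos (Real.rpow_pos_of_pos (by linarith) _) (by linarith)
  obtain ⟨M, hMdef⟩ : ∃ M, M = (1 - s) ^ r / (1 - r * s) := ⟨_, rfl⟩
  rw [← hMdef] at hM
  have hpos : ∀ x ∈ Ω, 0 ≤ 1 - r * σ x ∧ 0 < 1 - σ x := by
    intro x hx
    have h := (hσ x hx).1
    have := mul_le_mul_of_nonneg_left h.2 (show 0 ≤ r by linarith)
    exact ⟨by linarith, by linarith [h.2]⟩
  refine ⟨fun x => M * ((x.1 / (1 - σ x)) ^ r * (1 - r * σ x)), ?_, ?_, ?_, ?_, ?_⟩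
  · intro x hx
    have h1 := hpos x hx
    have h2 := ((hΩ x).1 hx).1
    have := h1.1
    have := h1.2
    positivity
  · apply ContinuousOn.mul continuousOn_const
    apply ContinuousOn.mul
    · refine ContinuousOn.rpow_const ?_ (fun _ _ => Or.inr (by linarith))
      exact continuousOn_fst.div (continuousOn_const.sub hσc) (fun x hx => (hpos x hx).2.ne')
    · exact continuousOn_const.sub (continuousOn_const.mul hσc)
  · intro x y hseg l hl
    obtain ⟨z, hz⟩ : ∃ z, z = l • x + (1 - l) • y := ⟨_, rfl⟩
    have hzs : z ∈ segment ℝ x y := ⟨l, 1 - l, hl.1, by linarith [hl.2], by ring, hz.symm⟩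
    have hzΩ := hseg hzs
    rw [← hz]
    obtain ⟨v, hv⟩ : ∃ v, v = z.1 / (1 - σ z) := ⟨_, rfl⟩
    obtain ⟨w, hw⟩ : ∃ w, w = z.2 / (1 + σ z / k) := ⟨_, rfl⟩
    have hfacts : ∀ u ∈ Ω, 0 < u.1 / (1 - σ u) ∧ 0 < u.2 / (1 + σ u / k) ∧
        (u.1 / (1 - σ u)) * (u.2 / (1 + σ u / k)) ^ k = Q ∧
        u.1 / (1 - σ u) * (1 - σ u) = u.1 ∧ u.2 / (1 + σ u / k) * (1 + σ u / k) = u.2 := by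
      intro u hu
      have h1 := (hpos u hu).2
      have h2 := (hΩ u).1 hu
      have h3 := hσ u hu
      have h4 : 0 < 1 + σ u / k := by
        have := div_nonneg h3.1.1 hk.le
        linarith
      refine ⟨div_pos h2.1 h1, div_pos h2.2.1 h4, ?_, div_mul_cancel₀ _ h1.ne', div_mul_cancel₀ _ h4.ne'⟩
      rw [Real.div_rpow h2.2.1.le h4.le, div_mul_div_comm, h3.2]
      have := h2.1
      have := h2.2.1
      field_simp
    have hzf := hfacts z hzΩ
    rw [← hv, ← hw] at hzf
    obtain ⟨hv0, hw0, hvw, hz1, hz2⟩ := hzf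
    have hdom : ∀ u ∈ segment ℝ x y, (u.1 / (1 - σ u)) ^ r * (1 - r * σ u) ≤
        v ^ r * (1 + r * (1 + k * r) / (1 + k) * (u.1 / v - 1)
          + k ^ 2 * r * (r - 1) / (1 + k) * (u.2 / w - 1)) := by
      intro u hus
      have hu := hseg hus
      obtain ⟨h1, h2, h3, h4, h5⟩ := hfacts u hu
      have hb := below_tangent (x := u) hk (hσ z hzΩ).1.1 hv0 hw0 hvw ((hΩ u).1 hu).2.1 (by
        intro t ht
        have hmem : (1 - t) • z + t • u ∈ segment ℝ x y :=
          (convex_segment x y) hzs hus (by linarith [ht.2]) ht.1 (by ring)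
        have := (hΩ _).1 (hseg hmem)
        simp only [Prod.fst_add, Prod.snd_add, Prod.smul_fst, Prod.smul_snd, smul_eq_mul] at this
        rw [hz1, hz2]
        exact ⟨this.2.1, this.2.2.2⟩)
      have := tangent_dominates (τ := σ u) (v := v) (w := w) hk hr (hσ u hu).1.1
        (by linarith [(hpos u hu).2]) hv0 hw0 h1 h2 (hvw.trans h3.symm) (by rwa [h4, h5])
      rwa [h4, h5] at this
    have hx := hdom x (left_mem_segment ℝ x y)
    have hy := hdom y (right_mem_segment ℝ x y)
    have hk1 : 0 < 1 + k := by linarith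
    have hval : v ^ r * (1 - r * σ z) =
        v ^ r * (1 + r * (1 + k * r) / (1 + k) * (z.1 / v - 1)
          + k ^ 2 * r * (r - 1) / (1 + k) * (z.2 / w - 1)) := by
      rw [← hz1, ← hz2]
      congr 1
      field_simp
      ring
    have hz1' : z.1 = l * x.1 + (1 - l) * y.1 := by rw [hz]; simp
    have hz2' : z.2 = l * x.2 + (1 - l) * y.2 := by rw [hz]; simp
    have hxl := mul_le_mul_of_nonneg_left hx hl.1
    have hyl := mul_le_mul_of_nonneg_left hy (show 0 ≤ 1 - l by linarith [hl.2])
    have htot : l * ((x.1 / (1 - σ x)) ^ r * (1 - r * σ x))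
        + (1 - l) * ((y.1 / (1 - σ y)) ^ r * (1 - r * σ y))
        ≤ (z.1 / (1 - σ z)) ^ r * (1 - r * σ z) := by
      rw [← hv, hval, hz1', hz2']
      refine (add_le_add hxl hyl).trans (le_of_eq ?_)
      ring
    have := mul_le_mul_of_nonneg_left htot hM.le
    linarith
  · intro x hx h1
    have h := hσ x hx
    have hσs : σ x = s := by
      apply hinj h.1 ⟨hs0, le_rfl⟩
      change (1 - σ x) * (1 + σ x / k) ^ k = (1 - s) * (1 + s / k) ^ k
      rw [h.2, hs, h1]
    have h2 : 0 < 1 - s := by linarith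
    have h3 : 1 - r * s ≠ 0 := by linarith
    have h4 := Real.rpow_pos_of_pos h2 r
    simp only [hσs]
    rw [hMdef, Real.div_rpow ((hΩ x).1 hx).1.le h2.le]
    generalize 1 - r * s = d at h3
    field_simp
  · refine ⟨M * ((1 - s) ^ r)⁻¹, ?_, ?_⟩
    · have : 0 < 1 - s := by linarith
      positivity
    · intro x hx
      have h := (hσ x hx).1
      have h2 : 0 < 1 - s := by linarith
      have h3 := ((hΩ x).1 hx).1
      have h4 := hpos x hx
      have h5 := h4.2
      rw [mul_assoc]
      refine mul_le_mul_of_nonneg_left ?_ hM.le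
      have e1 : (x.1 / (1 - σ x)) ^ r ≤ (x.1 / (1 - s)) ^ r := by
        apply Real.rpow_le_rpow (by positivity) _ (by linarith)
        gcongr
        exact h.2
      have e2 : 1 - r * σ x ≤ 1 := by
        have := mul_nonneg (show 0 ≤ r by linarith) h.1
        linarith
      calc _ ≤ (x.1 / (1 - s)) ^ r * 1 := mul_le_mul e1 e2 h4.1 (by positivity)
        _ = _ := by rw [Real.div_rpow h3.le h2.le]; ring

/-- Vasyunin's Bellman function for `A_p`: for `p, Q > 1`,
`p1 = -1/(p-1)` and `r ∈ (1/s⁻_{p1}(Q), p1] ∪ [1, 1/s⁺_{p1}(Q))` there is a nonnegative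
function `B_Q` on `Ω_Q = {1 ≤ x₁x₂^{p-1} ≤ Q}`, continuous, concave along segments lying
in `Ω_Q`, with `B_Q(x₁, x₁^{p1}) = x₁^r` and `B_Q(x) ≤ c(r,Q)·x₁^r` on `Ω_Q`. -/
theorem vasyunin_bellman_Ap
    (p Q p1 : ℝ) (hp : 1 < p) (hQ : 1 < Q) (hp1 : p1 = -1 / (p - 1))
    (sm : ℝ) (hsm_mem : sm ∈ Icc (1 / p1) 0)
    (hsm : (1 - sm) * (1 - p1 * sm) ^ (-1 / p1) = 1 / Q)
    (sp : ℝ) (hsp_mem : sp ∈ Icc (0:ℝ) 1)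
    (hsp : (1 - sp) * (1 - p1 * sp) ^ (-1 / p1) = 1 / Q)
    (r : ℝ) (hr : (1 / sm < r ∧ r ≤ p1) ∨ (1 ≤ r ∧ r < 1 / sp))
    (Ω : Set (ℝ × ℝ))
    (hΩ : Ω = {x : ℝ × ℝ | 0 < x.1 ∧ 0 < x.2 ∧
      1 ≤ x.1 * x.2 ^ (p - 1) ∧ x.1 * x.2 ^ (p - 1) ≤ Q}) :
    ∃ B : ℝ × ℝ → ℝ,
      (∀ x ∈ Ω, 0 ≤ B x) ∧
      ContinuousOn B Ω ∧
      (∀ x y : ℝ × ℝ, segment ℝ x y ⊆ Ω → ∀ l ∈ Icc (0:ℝ) 1,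
        l * B x + (1 - l) * B y ≤ B (l • x + (1 - l) • y)) ∧
      (∀ x1 : ℝ, 0 < x1 → B (x1, x1 ^ p1) = x1 ^ r) ∧
      (∃ c : ℝ, 0 < c ∧ ∀ x ∈ Ω, B x ≤ c * x.1 ^ r) := by
  have hk : 0 < p - 1 := by linarith
  obtain ⟨k, hkdef⟩ : ∃ k, k = p - 1 := ⟨_, rfl⟩
  rw [← hkdef] at hk hp1 hΩ
  have hp1neg : p1 < 0 := by rw [hp1]; exact div_neg_of_neg_of_pos (by norm_num) hk
  have hkp : -1 / p1 = k := by rw [hp1]; field_simp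
  have hQ0 : 0 < Q := by linarith
  have hmul : ∀ y, 1 - p1 * y = 1 + y / k := by intro y; rw [hp1]; field_simp; ring
  rw [hkp, hmul] at hsm hsp
  have hΩ' : ∀ x, x ∈ Ω ↔ 0 < x.1 ∧ 0 < x.2 ∧ 1 ≤ x.1 * x.2 ^ k ∧ x.1 * x.2 ^ k ≤ Q := by
    intro x; rw [hΩ]; rfl
  have hbd : ∀ a : ℝ, 0 < a → a * (a ^ p1) ^ k = 1 := by
    intro a ha
    rw [← Real.rpow_mul ha.le]
    have : p1 * k = -1 := by rw [hp1]; field_simp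
    rw [this, Real.rpow_neg_one, mul_inv_cancel₀ ha.ne']
  have hbdΩ : ∀ a : ℝ, 0 < a → (a, a ^ p1) ∈ Ω := by
    intro a ha
    rw [hΩ']
    exact ⟨ha, Real.rpow_pos_of_pos ha _, (hbd a ha).ge, by simp only [hbd a ha]; exact hQ.le⟩
  rcases hr with ⟨hr1, hr2⟩ | ⟨hr1, hr2⟩
  · have hr0 : r < 0 := by linarith
    have hsm0 : sm < 0 := by
      rcases hsm_mem.2.eq_or_lt with h | h
      · rw [h, div_zero] at hr1; linarith
      · exact h
    have hsmk : -k ≤ sm := by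
      have h1 : 1 / p1 = -k := by rw [← hkp]; ring
      linarith [hsm_mem.1]
    have hrsm : r * sm < 1 := by
      rw [div_lt_iff_of_neg hsm0] at hr1; exact hr1
    have hrk : 1 ≤ -(k * r) := by
      have : k * r ≤ k * p1 := mul_le_mul_of_nonneg_left hr2 hk.le
      have h2 : k * p1 = -1 := by rw [hp1]; field_simp
      linarith
    have hbase : 0 ≤ 1 + sm / k := by
      have : -1 ≤ sm / k := by rw [le_div_iff₀ hk]; linarith
      linarith
    have hs' : (1 - -(sm / k)) * (1 + -(sm / k) / (1 / k)) ^ (1 / k) = 1 / Q ^ (1 / k) := by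
      have h1 : 1 + -(sm / k) / (1 / k) = 1 - sm := by field_simp; ring
      have h2 := congrArg (fun y : ℝ => y ^ (1 / k)) hsm
      rw [Real.mul_rpow (by linarith) (by positivity), ← Real.rpow_mul hbase,
        mul_one_div_cancel hk.ne', Real.rpow_one, Real.div_rpow zero_le_one hQ0.le,
        Real.one_rpow] at h2
      rw [h1, ← h2]
      ring
    have hprod : ∀ x : ℝ × ℝ, 0 < x.1 → 0 < x.2 →
        x.2 * x.1 ^ (1 / k) = (x.1 * x.2 ^ k) ^ (1 / k) := by
      intro x h1 h2
      rw [Real.mul_rpow h1.le (by positivity), ← Real.rpow_mul h2.le,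
        mul_one_div_cancel hk.ne', Real.rpow_one, mul_comm]
    have hkinv : 0 < 1 / k := by positivity
    obtain ⟨B, b1, b2, b3, b4, c, hc, b5⟩ := exists_bellman_of_one_le (k := 1 / k)
      (Q := Q ^ (1 / k)) (s := -(sm / k)) (r := -(k * r)) (Ω := Prod.swap ⁻¹' Ω) hkinv
      (Real.one_lt_rpow hQ hkinv)
      (by have := div_nonpos_of_nonpos_of_nonneg hsm0.le hk.le; linarith)
      (by linarith) hs' hrk
      (by have : -(k * r) * -(sm / k) = r * sm := by field_simp
          rw [this]; exact hrsm)
      (by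
        intro x
        rw [mem_preimage, hΩ']
        simp only [Prod.fst_swap, Prod.snd_swap]
        constructor
        · rintro ⟨h1, h2, h3, h4⟩
          have e := hprod x.swap h1 h2
          simp only [Prod.fst_swap, Prod.snd_swap] at e
          rw [e]
          exact ⟨h2, h1, Real.one_le_rpow h3 hkinv.le,
            Real.rpow_le_rpow (by positivity) h4 hkinv.le⟩
        · rintro ⟨h1, h2, h3, h4⟩
          have e := hprod x.swap h2 h1
          simp only [Prod.fst_swap, Prod.snd_swap] at e
          rw [e] at h3 h4
          refine ⟨h2, h1, ?_, (Real.rpow_le_rpow_iff (by positivity) hQ0.le hkinv).1 h4⟩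
          by_contra hcon
          push Not at hcon
          exact absurd h3 (Real.rpow_lt_one (by positivity) hcon hkinv).not_ge)
    have hkr : ∀ x : ℝ × ℝ, 0 < x.1 → 0 < x.2 →
        x.2 ^ (-(k * r)) = (x.1 * x.2 ^ k) ^ (-r) * x.1 ^ r := by
      intro x h1 h2
      rw [Real.mul_rpow h1.le (by positivity), ← Real.rpow_mul h2.le, mul_right_comm,
        ← Real.rpow_add h1, neg_add_cancel, Real.rpow_zero, one_mul, mul_neg]
    refine ⟨fun x => B x.swap, fun x hx => b1 _ (by simpa using hx), ?_, ?_, ?_, ?_⟩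
    · exact b2.comp continuous_swap.continuousOn (fun x hx => by simpa using hx)
    · intro x y hseg l hl
      refine b3 x.swap y.swap ?_ l hl
      rintro _ ⟨a, b, ha, hb, hab, rfl⟩
      exact hseg ⟨a, b, ha, hb, hab, rfl⟩
    · intro a ha
      have hm := hbdΩ a ha
      have hpos : 0 < a ^ p1 := Real.rpow_pos_of_pos ha _
      have := b4 (a ^ p1, a) (by simpa using hm) (by
        have e := hprod (a, a ^ p1) ha hpos
        simp only at e
        simp only [e, hbd a ha, Real.one_rpow])
      simp only [Prod.swap_prod_mk]
      rw [this]
      have e := hkr (a, a ^ p1) ha hpos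
      simp only [hbd a ha, Real.one_rpow, one_mul] at e
      exact e
    · refine ⟨c * Q ^ (-r), by positivity, fun x hx => ?_⟩
      obtain ⟨h1, h2, h3, h4⟩ := (hΩ' x).1 hx
      refine (b5 x.swap (by simpa using hx)).trans ?_
      rw [Prod.fst_swap, hkr x h1 h2, mul_assoc]
      refine mul_le_mul_of_nonneg_left ?_ hc.le
      refine mul_le_mul_of_nonneg_right ?_ (by positivity)
      exact Real.rpow_le_rpow (by positivity) h4 (by linarith)
  · have hsp0 : 0 < sp := by
      rcases hsp_mem.1.eq_or_lt with h | h
      · rw [← h, div_zero] at hr2; linarith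
      · exact h
    rw [lt_div_iff₀ hsp0] at hr2
    obtain ⟨B, b1, b2, b3, b4, b5⟩ :=
      exists_bellman_of_one_le hk hQ hsp_mem.1 hsp_mem.2 hsp hr1 hr2 hΩ'
    exact ⟨B, b1, b2, b3, fun a ha => b4 (a, a ^ p1) (hbdΩ a ha) (hbd a ha), b5⟩
end
end

section
/- (Vasyunin's Bellman function for RH_p.) Fix p > 1, fix Q > 1, and fix r ∈ (1/s⁻_p(Q), 1] ∪ [p, 1/s⁺_p(Q)). Then there exists a nonnegative function B_Q defined on the domain Ω_Q := {x = (x₁, x₂) ∈ ℝ² : x₁ > 0, x₂ > 0, 1 ≤ x₁ · x₂^{-1/p} ≤ Q} such that: (i) B_Q is continuous on Ω_Q; (ii) B_Q is concave along line segments contained in Ω_Q, i.e. for every segment [x⁻, x⁺] ⊂ Ω_Q and every λ ∈ [0,1], B_Q(λx⁻ + (1-λ)x⁺) ≥ λ B_Q(x⁻) + (1-λ) B_Q(x⁺); (iii) B_Q(x₁, x₁^{p}) = x₁^r for every x₁ > 0; (iv) there is a finite constant c(r,Q) > 0 with B_Q(x) ≤ c(r,Q) · x₁^r for every x ∈ Ω_Q.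 -/
open Set Filter

noncomputable section

/-- The value at `y` of the tangent line to `x ↦ x ^ q` at the point `a`. -/
def rpowTangent (q a y : ℝ) : ℝ := q * a ^ (q - 1) * y - (q - 1) * a ^ q

theorem rpowTangent_self (q : ℝ) {a : ℝ} (ha : 0 < a) : rpowTangent q a a = a ^ q := by
  rw [rpowTangent, Real.rpow_sub_one ha.ne']
  field_simp
  ring

theorem rpowTangent_mul (q : ℝ) {y t : ℝ} (hy : 0 < y) (ht : 0 < t) :
    rpowTangent q (y * t) y = y ^ q * rpowTangent q t 1 := by
  rw [rpowTangent, rpowTangent, Real.mul_rpow hy.le ht.le, Real.mul_rpow hy.le ht.le,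
    Real.rpow_sub_one hy.ne']
  field_simp

theorem hasDerivAt_rpowTangent (q y : ℝ) {a : ℝ} (ha : 0 < a) :
    HasDerivAt (fun a => rpowTangent q a y) (q * (q - 1) * a ^ (q - 2) * (y - a)) a := by
  have h := (((Real.hasDerivAt_rpow_const (p := q - 1) (Or.inl ha.ne')).const_mul q).mul_const
    y).sub ((Real.hasDerivAt_rpow_const (p := q) (Or.inl ha.ne')).const_mul (q - 1))
  refine h.congr_deriv ?_
  rw [show q - 1 - 1 = q - 2 by ring, show q - 1 = q - 2 + 1 by ring, Real.rpow_add_one ha.ne']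
  ring

theorem continuousOn_rpowTangent (q y : ℝ) :
    ContinuousOn (fun a => rpowTangent q a y) (Ioi 0) :=
  fun _ ha => (hasDerivAt_rpowTangent q y ha).continuousAt.continuousWithinAt

theorem strictMonoOn_rpowTangent {q : ℝ} (hq : 1 < q) (y : ℝ) :
    StrictMonoOn (fun a => rpowTangent q a y) (Ioc 0 y) := by
  refine strictMonoOn_of_deriv_pos (convex_Ioc 0 y)
    ((continuousOn_rpowTangent q y).mono fun _ h => h.1) fun a ha => ?_
  rw [interior_Ioc] at ha
  rw [(hasDerivAt_rpowTangent q y ha.1).deriv]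
  have := Real.rpow_pos_of_pos ha.1 (q - 2)
  have := sub_pos.2 ha.2
  have := sub_pos.2 hq
  positivity

theorem strictAntiOn_rpowTangent {q y : ℝ} (hq : 1 < q) (hy : 0 < y) :
    StrictAntiOn (fun a => rpowTangent q a y) (Ici y) := by
  refine strictAntiOn_of_deriv_neg (convex_Ici y)
    ((continuousOn_rpowTangent q y).mono fun _ h => hy.trans_le h) fun a ha => ?_
  rw [interior_Ici] at ha
  have ha0 : 0 < a := hy.trans ha
  rw [(hasDerivAt_rpowTangent q y ha0).deriv]
  have := Real.rpow_pos_of_pos ha0 (q - 2)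
  have := sub_pos.2 hq
  exact mul_neg_of_pos_of_neg (by positivity) (sub_neg.2 ha)

theorem injOn_rpowTangent_uIcc {q T : ℝ} (hq : 1 < q) (hT : 0 < T) :
    InjOn (fun a => rpowTangent q a 1) (uIcc 1 T) := by
  rcases le_total 1 T with h | h
  · rw [uIcc_of_le h]
    exact (strictAntiOn_rpowTangent hq one_pos).injOn.mono Icc_subset_Ici_self
  · rw [uIcc_of_ge h]
    exact (strictMonoOn_rpowTangent hq 1).injOn.mono fun a ha =>
      (⟨hT.trans_le ha.1, ha.2⟩ : a ∈ Ioc 0 1)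

/-- The affine function of `(x, y)` supporting the Bellman function along the tangent line to
`y = x ^ p` at the point with abscissa `a`. -/
def bellmanSupport (p r a : ℝ) (x : ℝ × ℝ) : ℝ :=
  rpowTangent r a x.1 +
    r * (r - 1) / (p * (p - 1)) * a ^ (r - p) * (x.2 - rpowTangent p a x.1)

theorem bellmanSupport_combo (p r a : ℝ) (x y : ℝ × ℝ) (l : ℝ) :
    bellmanSupport p r a (l • x + (1 - l) • y) =
      l * bellmanSupport p r a x + (1 - l) * bellmanSupport p r a y := by
  simp only [bellmanSupport, rpowTangent, Prod.fst_add, Prod.snd_add, Prod.smul_fst,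
    Prod.smul_snd, smul_eq_mul]
  ring

theorem hasDerivAt_bellmanSupport {p : ℝ} (hp : 1 < p) (r : ℝ) (x : ℝ × ℝ) {a : ℝ}
    (ha : 0 < a) :
    HasDerivAt (fun a => bellmanSupport p r a x)
      (r * (r - 1) / (p * (p - 1)) * a ^ (r - p - 1) *
        ((r - p) * (x.2 - rpowTangent p a x.1))) a := by
  have h := (hasDerivAt_rpowTangent r x.1 ha).add
    (((Real.hasDerivAt_rpow_const (p := r - p) (Or.inl ha.ne')).const_mul
      (r * (r - 1) / (p * (p - 1)))).mul ((hasDerivAt_rpowTangent p x.1 ha).const_sub x.2))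
  refine h.congr_deriv ?_
  have h1 : a ^ (r - 2) = a ^ (r - p) * a ^ (p - 2) := by
    rw [← Real.rpow_add ha]; congr 1; ring
  have h2 : p - 1 ≠ 0 := by linarith
  have h3 : p ≠ 0 := by linarith
  rw [h1]
  field_simp
  ring

theorem rpowTangent_le_bellmanSupport {p r a b : ℝ} {x : ℝ × ℝ} (hp : 1 < p)
    (hr : 0 ≤ r * (r - 1)) (hb : 0 < b) (hxb : x.2 = rpowTangent p b x.1) (ha : 0 < a)
    (hba : ∀ c ∈ Ioo b a, 0 ≤ (r - p) * (x.2 - rpowTangent p c x.1))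
    (hab : ∀ c ∈ Ioo a b, (r - p) * (x.2 - rpowTangent p c x.1) ≤ 0) :
    rpowTangent r b x.1 ≤ bellmanSupport p r a x := by
  have hC : 0 ≤ r * (r - 1) / (p * (p - 1)) :=
    div_nonneg hr (mul_nonneg (by linarith) (by linarith))
  have heq : rpowTangent r b x.1 = bellmanSupport p r b x := by simp [bellmanSupport, hxb]
  let f' : ℝ → ℝ := fun c => r * (r - 1) / (p * (p - 1)) * c ^ (r - p - 1) *
    ((r - p) * (x.2 - rpowTangent p c x.1))
  have hderiv : ∀ c, 0 < c → HasDerivAt (fun a => bellmanSupport p r a x) (f' c) c :=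
    fun c hc => hasDerivAt_bellmanSupport hp r x hc
  have hcont : ∀ u, 0 < u → ∀ v, ContinuousOn (fun a => bellmanSupport p r a x) (Icc u v) :=
    fun u hu v c hc => (hderiv c (hu.trans_le hc.1)).continuousAt.continuousWithinAt
  rw [heq]
  rcases le_total b a with h | h
  · refine monotoneOn_of_hasDerivWithinAt_nonneg (f' := f') (convex_Icc b a) (hcont b hb a)
      (fun c hc => ?_) (fun c hc => ?_) (left_mem_Icc.2 h) (right_mem_Icc.2 h) h
    · exact (hderiv c (hb.trans_le (interior_subset hc).1)).hasDerivWithinAt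
    · rw [interior_Icc] at hc
      exact mul_nonneg (mul_nonneg hC (Real.rpow_nonneg (hb.trans hc.1).le _)) (hba c hc)
  · refine antitoneOn_of_hasDerivWithinAt_nonpos (f' := f') (convex_Icc a b) (hcont a ha b)
      (fun c hc => ?_) (fun c hc => ?_) (left_mem_Icc.2 h) (right_mem_Icc.2 h) h
    · exact (hderiv c (ha.trans_le (interior_subset hc).1)).hasDerivWithinAt
    · rw [interior_Icc] at hc
      exact mul_nonpos_of_nonneg_of_nonpos
        (mul_nonneg hC (Real.rpow_nonneg (ha.trans hc.1).le _)) (hab c hc)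

theorem rpowTangent_le_bellmanSupport_of_ge {p r a b : ℝ} {x : ℝ × ℝ} (hp : 1 < p)
    (hr : p ≤ r) (hx : 0 < x.1) (hb : x.1 ≤ b) (hxb : x.2 = rpowTangent p b x.1) (ha : 0 < a)
    (h : a < x.1 → x.2 ≤ rpowTangent p a x.1) :
    rpowTangent r b x.1 ≤ bellmanSupport p r a x := by
  have hanti := (strictAntiOn_rpowTangent hp hx).antitoneOn
  have hmono := (strictMonoOn_rpowTangent hp x.1).monotoneOn
  refine rpowTangent_le_bellmanSupport hp (mul_nonneg (by linarith) (by linarith))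
    (hx.trans_le hb) hxb ha (fun c hc => mul_nonneg (by linarith) (sub_nonneg.2 ?_))
    (fun c hc => mul_nonpos_of_nonneg_of_nonpos (by linarith) (sub_nonpos.2 ?_))
  · exact (hanti (mem_Ici.2 hb) (mem_Ici.2 (hb.trans hc.1.le)) hc.1.le).trans_eq hxb.symm
  · rcases le_total x.1 c with hxc | hcx
    · exact hxb.trans_le (hanti (mem_Ici.2 hxc) (mem_Ici.2 hb) hc.2.le)
    · exact (h (hc.1.trans_le hcx)).trans
        (hmono ⟨ha, hc.1.le.trans hcx⟩ ⟨ha.trans hc.1, hcx⟩ hc.1.le)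

theorem rpowTangent_le_bellmanSupport_of_le {p r a b : ℝ} {x : ℝ × ℝ} (hp : 1 < p)
    (hr : r ≤ 0) (hb₀ : 0 < b) (hb : b ≤ x.1) (hxb : x.2 = rpowTangent p b x.1) (ha : 0 < a)
    (h : x.1 < a → x.2 ≤ rpowTangent p a x.1) :
    rpowTangent r b x.1 ≤ bellmanSupport p r a x := by
  have hanti := (strictAntiOn_rpowTangent hp (hb₀.trans_le hb)).antitoneOn
  have hmono := (strictMonoOn_rpowTangent hp x.1).monotoneOn
  refine rpowTangent_le_bellmanSupport hp
    (mul_nonneg_of_nonpos_of_nonpos (by linarith) (by linarith)) hb₀ hxb ha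
    (fun c hc => mul_nonneg_of_nonpos_of_nonpos (by linarith) (sub_nonpos.2 ?_))
    (fun c hc => mul_nonpos_of_nonpos_of_nonneg (by linarith) (sub_nonneg.2 ?_))
  · rcases le_total x.1 c with hxc | hcx
    · exact (h (hxc.trans_lt hc.2)).trans
        (hanti (mem_Ici.2 hxc) (mem_Ici.2 (hxc.trans hc.2.le)) hc.2.le)
    · exact hxb.trans_le (hmono ⟨hb₀, hb⟩ ⟨hb₀.trans hc.1, hcx⟩ hc.1.le)
  · exact (hmono ⟨ha.trans hc.1, hc.2.le.trans hb⟩ ⟨hb₀, hb⟩ hc.2.le).trans_eq hxb.symm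

/-- A segment below the graph of `x ↦ x ^ p` whose endpoint `z` lies on the tangent line at `a`
does not rise above that line on the other side of `a`. -/
theorem le_rpowTangent_of_segment {p a : ℝ} {x z : ℝ × ℝ} (ha : 0 < a)
    (hz : z.2 = rpowTangent p a z.1) (hxz : (z.1 < a ∧ a < x.1) ∨ (a < z.1 ∧ x.1 < a) ∨ z.1 = a)
    (h : ∀ w ∈ segment ℝ z x, w.2 ≤ w.1 ^ p) : x.2 ≤ rpowTangent p a x.1 := by
  have hself := rpowTangent_self p ha
  by_cases hza : z.1 = a
  · rw [hza, hself] at hz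
    have hmin : IsLocalMinOn (fun t : ℝ => (a + t * (x.1 - a)) ^ p - (a ^ p + t * (x.2 - a ^ p)))
        (Icc 0 1) 0 := by
      refine (isMinOn_iff.2 fun t ht => ?_).localize
      have := h (z + t • (x - z)) (by
        rw [segment_eq_image']; exact ⟨t, ht, rfl⟩)
      simp only [Prod.snd_add, Prod.smul_snd, Prod.snd_sub, Prod.fst_add, Prod.smul_fst,
        Prod.fst_sub, smul_eq_mul, hza, hz] at this
      simpa using this
    have hd : HasDerivAt
        (fun t : ℝ => (a + t * (x.1 - a)) ^ p - (a ^ p + t * (x.2 - a ^ p)))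
        ((x.1 - a) * p * a ^ (p - 1) - (x.2 - a ^ p)) 0 := by
      have h1 : HasDerivAt (fun t : ℝ => a + t * (x.1 - a)) (x.1 - a) 0 := by
        simpa using ((hasDerivAt_id (0 : ℝ)).mul_const (x.1 - a)).const_add a
      have h2 : HasDerivAt (fun t : ℝ => a ^ p + t * (x.2 - a ^ p)) (x.2 - a ^ p) 0 := by
        simpa using ((hasDerivAt_id (0 : ℝ)).mul_const (x.2 - a ^ p)).const_add (a ^ p)
      have h3 := (h1.rpow_const (p := p) (Or.inl (by simpa using ha.ne'))).fun_sub h2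
      simpa using h3
    have hmem : (1 : ℝ) ∈ posTangentConeAt (Icc (0 : ℝ) 1) 0 :=
      mem_posTangentConeAt_of_segment_subset (by simp [segment_eq_Icc])
    have hnn := hmin.hasFDerivWithinAt_nonneg hd.hasFDerivAt.hasFDerivWithinAt hmem
    simp only [ContinuousLinearMap.toSpanSingleton_apply, smul_eq_mul, one_mul] at hnn
    rw [rpowTangent] at hself ⊢
    linarith
  · have hne : x.1 - z.1 ≠ 0 := by
      rcases hxz with ⟨h1, h2⟩ | ⟨h1, h2⟩ | h1
      · linarith
      · linarith
      · exact absurd h1 hza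
    set m := (a - z.1) / (x.1 - z.1) with hm
    have hmul : m * (x.1 - z.1) = a - z.1 := div_mul_cancel₀ _ hne
    have hm01 : 0 < m ∧ m ≤ 1 := by
      rcases hxz with ⟨h1, h2⟩ | ⟨h1, h2⟩ | h1
      · rw [hm, div_le_one (by linarith)]
        exact ⟨div_pos (by linarith) (by linarith), by linarith⟩
      · rw [hm, div_le_one_of_neg (by linarith)]
        exact ⟨div_pos_of_neg_of_neg (by linarith) (by linarith), by linarith⟩
      · exact absurd h1 hza
    have := h (z + m • (x - z)) (by
      rw [segment_eq_image']; exact ⟨m, ⟨hm01.1.le, hm01.2⟩, rfl⟩)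
    simp only [Prod.snd_add, Prod.smul_snd, Prod.snd_sub, Prod.fst_add, Prod.smul_fst,
      Prod.fst_sub, smul_eq_mul, hmul, add_sub_cancel] at this
    rw [hz, ← hself] at this
    have hlin : rpowTangent p a a = rpowTangent p a z.1 +
        m * (rpowTangent p a x.1 - rpowTangent p a z.1) := by
      simp only [rpowTangent]
      linear_combination (-(p * a ^ (p - 1))) * hmul
    rw [hlin] at this
    exact sub_le_sub_iff_right _ |>.1
      (le_of_mul_le_mul_left (add_le_add_iff_left _ |>.1 this) hm01.1)

theorem IsCompact.exists_continuousOn_rightInverse {X Y : Type*} [TopologicalSpace X]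
    [TopologicalSpace Y] [T2Space Y] [Nonempty X] {K : Set X} (hK : IsCompact K) {f : X → Y}
    (hf : ContinuousOn f K) (hinj : InjOn f K) :
    ∃ g : Y → X, ContinuousOn g (f '' K) ∧ ∀ y ∈ f '' K, g y ∈ K ∧ f (g y) = y := by
  refine ⟨Function.invFunOn f K, ?_, fun y hy => ⟨Function.invFunOn_mem hy,
    Function.invFunOn_eq hy⟩⟩
  rw [continuousOn_iff_isClosed]
  intro t ht
  refine ⟨f '' (K ∩ t), ((hK.inter_right ht).image_of_continuousOn
    (hf.mono inter_subset_left)).isClosed, ?_⟩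
  ext y
  constructor
  · rintro ⟨hy, hyK⟩
    exact ⟨⟨_, ⟨Function.invFunOn_mem hyK, hy⟩, Function.invFunOn_eq hyK⟩, hyK⟩
  · rintro ⟨⟨x, ⟨hxK, hxt⟩, rfl⟩, hyK⟩
    refine ⟨?_, hyK⟩
    rw [mem_preimage, hinj.leftInvOn_invFunOn hxK]
    exact hxt

theorem exists_bellman_of_tangent {p r T : ℝ} (hp : 1 < p) (hT : 0 < T)
    (hTr : (1 ≤ T ∧ p ≤ r) ∨ (T ≤ 1 ∧ r ≤ 0)) (hnn : 0 ≤ r - (r - 1) * T)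
    {Ω : Set (ℝ × ℝ)}
    (hΩ : ∀ x ∈ Ω, 0 < x.1 ∧ x.2 / x.1 ^ p ∈ Icc (rpowTangent p T 1) 1) :
    ∃ B : ℝ × ℝ → ℝ,
      (∀ x ∈ Ω, 0 ≤ B x) ∧
      ContinuousOn B Ω ∧
      (∀ x y : ℝ × ℝ, segment ℝ x y ⊆ Ω → ∀ l ∈ Icc (0 : ℝ) 1,
        l * B x + (1 - l) * B y ≤ B (l • x + (1 - l) • y)) ∧
      (∀ x1 : ℝ, 0 < x1 → B (x1, x1 ^ p) = x1 ^ r) ∧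
      (∃ c : ℝ, 0 < c ∧ ∀ x ∈ Ω, B x ≤ c * x.1 ^ r) := by
  have hpos : ∀ t ∈ uIcc 1 T, 0 < t := fun t ht => (lt_min one_pos hT).trans_le ht.1
  have hcont : ∀ q, ContinuousOn (fun t => rpowTangent q t 1) (uIcc 1 T) := fun q =>
    (continuousOn_rpowTangent q 1).mono hpos
  have hinj := injOn_rpowTangent_uIcc hp hT
  have himage : Icc (rpowTangent p T 1) 1 ⊆ (fun t => rpowTangent p t 1) '' uIcc 1 T := by
    refine Subset.trans ?_ (intermediate_value_uIcc (hcont p))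
    simp only [rpowTangent_self p one_pos, Real.one_rpow]
    rw [uIcc_comm]
    exact Icc_subset_uIcc
  obtain ⟨g, hg, hgK⟩ := isCompact_uIcc.exists_continuousOn_rightInverse (hcont p) hinj
  have hfst : ContinuousOn (fun x : ℝ × ℝ => x.1) Ω := continuous_fst.continuousOn
  have hpow : ∀ q : ℝ, ContinuousOn (fun x : ℝ × ℝ => x.1 ^ q) Ω := fun q =>
    hfst.rpow_const fun x hx => Or.inl (hΩ x hx).1.ne'
  have hratio : ContinuousOn (fun x : ℝ × ℝ => x.2 / x.1 ^ p) Ω :=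
    continuous_snd.continuousOn.div (hpow p) fun x hx =>
      (Real.rpow_pos_of_pos (hΩ x hx).1 p).ne'
  have hmem : ∀ x ∈ Ω, g (x.2 / x.1 ^ p) ∈ uIcc 1 T := fun x hx =>
    (hgK _ (himage (hΩ x hx).2)).1
  have hb : ∀ x ∈ Ω, 0 < x.1 * g (x.2 / x.1 ^ p) ∧
      x.2 = rpowTangent p (x.1 * g (x.2 / x.1 ^ p)) x.1 := by
    intro x hx
    have hx1 := (hΩ x hx).1
    refine ⟨mul_pos hx1 (hpos _ (hmem x hx)), ?_⟩
    rw [rpowTangent_mul p hx1 (hpos _ (hmem x hx)), (hgK _ (himage (hΩ x hx).2)).2,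
      mul_div_cancel₀ _ (Real.rpow_pos_of_pos hx1 p).ne']
  have hB : ∀ x ∈ Ω, rpowTangent r (x.1 * g (x.2 / x.1 ^ p)) x.1 =
      x.1 ^ r * rpowTangent r (g (x.2 / x.1 ^ p)) 1 := fun x hx =>
    rpowTangent_mul r (hΩ x hx).1 (hpos _ (hmem x hx))
  have hsupp : ∀ x z, segment ℝ z x ⊆ Ω → rpowTangent r (x.1 * g (x.2 / x.1 ^ p)) x.1 ≤
      bellmanSupport p r (z.1 * g (z.2 / z.1 ^ p)) x := by
    intro x z hseg
    have hz := hseg (left_mem_segment ℝ z x)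
    have hx := hseg (right_mem_segment ℝ z x)
    have hbelow : ∀ w ∈ segment ℝ z x, w.2 ≤ w.1 ^ p := fun w hw =>
      (div_le_one (Real.rpow_pos_of_pos (hΩ w (hseg hw)).1 p)).1 (hΩ w (hseg hw)).2.2
    obtain ⟨ha, hza⟩ := hb z hz
    obtain ⟨hb₀, hxb⟩ := hb x hx
    have hx1 := (hΩ x hx).1
    have hz1 := (hΩ z hz).1
    have hgx := hmem x hx
    have hgz := hmem z hz
    rcases hTr with ⟨hT1, hr⟩ | ⟨hT1, hr⟩
    · rw [uIcc_of_le hT1] at hgx hgz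
      refine rpowTangent_le_bellmanSupport_of_ge hp hr hx1 (le_mul_of_one_le_right hx1.le hgx.1)
        hxb ha fun hax => le_rpowTangent_of_segment ha hza ?_ hbelow
      rcases (le_mul_of_one_le_right hz1.le hgz.1).lt_or_eq with h | h
      exacts [Or.inl ⟨h, hax⟩, Or.inr (Or.inr h)]
    · rw [uIcc_of_ge hT1] at hgx hgz
      refine rpowTangent_le_bellmanSupport_of_le hp hr hb₀ (mul_le_of_le_one_right hx1.le hgx.2)
        hxb ha fun hax => le_rpowTangent_of_segment ha hza ?_ hbelow
      rcases (mul_le_of_le_one_right hz1.le hgz.2).lt_or_eq with h | h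
      exacts [Or.inr (Or.inl ⟨h, hax⟩), Or.inr (Or.inr h.symm)]
  refine ⟨fun x => rpowTangent r (x.1 * g (x.2 / x.1 ^ p)) x.1, fun x hx => ?_, ?_, ?_, ?_, ?_⟩
  · obtain ⟨ht1, ht2⟩ := hmem x hx
    have ht0 := hpos _ (hmem x hx)
    simp only [hB x hx]
    refine mul_nonneg (Real.rpow_nonneg (hΩ x hx).1.le _) ?_
    rw [rpowTangent]
    generalize g (x.2 / x.1 ^ p) = t at *
    have hlin : 0 ≤ r - (r - 1) * t := by
      rcases hTr with ⟨hT1, hr⟩ | ⟨hT1, hr⟩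
      · rw [max_eq_right hT1] at ht2
        nlinarith
      · rw [min_eq_right hT1] at ht1
        nlinarith
    have : r * t ^ (r - 1) * 1 - (r - 1) * t ^ r = t ^ (r - 1) * (r - (r - 1) * t) := by
      rw [Real.rpow_sub_one ht0.ne']
      field_simp
    rw [this]
    exact mul_nonneg (Real.rpow_nonneg ht0.le _) hlin
  · refine ContinuousOn.congr ((hpow r).mul ((hcont r).comp (hg.comp hratio fun x hx => ?_)
      fun x hx => ?_)) hB
    · exact himage (hΩ x hx).2
    · exact hmem x hx
  · intro x y hseg l hl
    have hzmem : l • x + (1 - l) • y ∈ segment ℝ x y :=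
      ⟨l, 1 - l, hl.1, by linarith [hl.2], by ring, rfl⟩
    set z := l • x + (1 - l) • y with hz
    have h1 := hsupp x z (((convex_segment x y).segment_subset hzmem
      (left_mem_segment ℝ x y)).trans hseg)
    have h2 := hsupp y z (((convex_segment x y).segment_subset hzmem
      (right_mem_segment ℝ x y)).trans hseg)
    have h3 : rpowTangent r (z.1 * g (z.2 / z.1 ^ p)) z.1 =
        bellmanSupport p r (z.1 * g (z.2 / z.1 ^ p)) z := by
      rw [bellmanSupport, ← (hb z (hseg hzmem)).2, sub_self, mul_zero, add_zero]
    simp only [h3]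
    nth_rewrite 4 [hz]
    rw [bellmanSupport_combo]
    have := sub_nonneg.2 hl.2
    have := hl.1
    gcongr
  · intro y hy
    have h1 : g 1 = 1 := by
      have h := hgK 1 ⟨1, left_mem_uIcc, by simp [rpowTangent]⟩
      exact hinj h.1 left_mem_uIcc (by simpa [rpowTangent] using h.2)
    simp only [div_self (Real.rpow_pos_of_pos hy p).ne', h1, mul_one, rpowTangent_self r hy]
  · obtain ⟨c, hc⟩ := (isCompact_uIcc.image_of_continuousOn (hcont r)).bddAbove
    refine ⟨max c 1, by positivity, fun x hx => ?_⟩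
    simp only [hB x hx]
    rw [mul_comm]
    exact mul_le_mul_of_nonneg_right
      ((hc (mem_image_of_mem _ (hmem x hx))).trans (le_max_left c 1))
      (Real.rpow_nonneg (hΩ x hx).1.le _)

theorem rpowTangent_inv_one {p Q s : ℝ} (hp : 0 < p) (hQ : 0 < Q) (hs : s < 1)
    (hps : p * s ≤ 1) (h : (1 - p * s) ^ (1 / p) * (1 - s)⁻¹ = 1 / Q) :
    rpowTangent p (1 - s)⁻¹ 1 = Q ^ (-p) := by
  have hs' : 0 < 1 - s := sub_pos.2 hs
  have hps' : 0 ≤ 1 - p * s := sub_nonneg.2 hps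
  have h' := congrArg (· ^ p) h
  simp only [one_div] at h'
  rw [Real.mul_rpow (Real.rpow_nonneg hps' _) (inv_nonneg.2 hs'.le),
    Real.rpow_inv_rpow hps' hp.ne', Real.inv_rpow hQ.le, ← Real.rpow_neg hQ.le] at h'
  rw [rpowTangent, Real.rpow_sub_one (inv_pos.2 hs').ne', ← h']
  field_simp
  ring

theorem div_rpow_mem_Icc {p Q : ℝ} (hp : 0 < p) {x : ℝ × ℝ} (hx₁ : 0 < x.1)
    (hx₂ : 0 < x.2) (h₁ : 1 ≤ x.1 * x.2 ^ (-1 / p)) (h₂ : x.1 * x.2 ^ (-1 / p) ≤ Q) :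
    x.2 / x.1 ^ p ∈ Icc (Q ^ (-p)) 1 := by
  have h : x.2 / x.1 ^ p = (x.1 * x.2 ^ (-1 / p)) ^ (-p) := by
    rw [Real.mul_rpow hx₁.le (Real.rpow_nonneg hx₂.le _), ← Real.rpow_mul hx₂.le,
      show -1 / p * -p = 1 by field_simp, Real.rpow_one, Real.rpow_neg hx₁.le]
    ring
  rw [h]
  exact ⟨Real.rpow_le_rpow_of_nonpos (one_pos.trans_le h₁) h₂ (neg_nonpos.2 hp.le),
    Real.rpow_le_one_of_one_le_of_nonpos h₁ (neg_nonpos.2 hp.le)⟩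

/-- Vasyunin's Bellman function for `RH_p`: for `p, Q > 1` and
`r ∈ (1/s⁻_p(Q), 1] ∪ [p, 1/s⁺_p(Q))` there is a nonnegative function `B_Q` on
`Ω_Q = {1 ≤ x₁x₂^{-1/p} ≤ Q}`, continuous, concave along segments lying in `Ω_Q`, with
`B_Q(x₁, x₁^p) = x₁^r` and `B_Q(x) ≤ c(r,Q)·x₁^r` on `Ω_Q`. -/
theorem vasyunin_bellman_RHp
    (p Q : ℝ) (hp : 1 < p) (hQ : 1 < Q)
    (sm : ℝ) (hsm_mem : sm ∈ Iic (0:ℝ))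
    (hsm : (1 - p * sm) ^ (1 / p) * (1 - sm)⁻¹ = 1 / Q)
    (sp : ℝ) (hsp_mem : sp ∈ Icc (0:ℝ) (1 / p))
    (hsp : (1 - p * sp) ^ (1 / p) * (1 - sp)⁻¹ = 1 / Q)
    (r : ℝ) (hr : (1 / sm < r ∧ r ≤ 1) ∨ (p ≤ r ∧ r < 1 / sp))
    (Ω : Set (ℝ × ℝ))
    (hΩ : Ω = {x : ℝ × ℝ | 0 < x.1 ∧ 0 < x.2 ∧
      1 ≤ x.1 * x.2 ^ (-1 / p) ∧ x.1 * x.2 ^ (-1 / p) ≤ Q}) :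
    ∃ B : ℝ × ℝ → ℝ,
      (∀ x ∈ Ω, 0 ≤ B x) ∧
      ContinuousOn B Ω ∧
      (∀ x y : ℝ × ℝ, segment ℝ x y ⊆ Ω → ∀ l ∈ Icc (0:ℝ) 1,
        l * B x + (1 - l) * B y ≤ B (l • x + (1 - l) • y)) ∧
      (∀ x1 : ℝ, 0 < x1 → B (x1, x1 ^ p) = x1 ^ r) ∧
      (∃ c : ℝ, 0 < c ∧ ∀ x ∈ Ω, B x ≤ c * x.1 ^ r) := by
  have hp0 : 0 < p := one_pos.trans hp
  have hQ0 : 0 < Q := one_pos.trans hQ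
  have hne : 1 / Q ≠ 1 := fun h => hQ.ne' (by simpa using h)
  have hdom : ∀ x ∈ Ω, 0 < x.1 ∧ x.2 / x.1 ^ p ∈ Icc (Q ^ (-p)) 1 := by
    rw [hΩ]
    exact fun x hx => ⟨hx.1, div_rpow_mem_Icc hp0 hx.1 hx.2.1 hx.2.2.1 hx.2.2.2⟩
  rcases hr with ⟨hr1, hr2⟩ | ⟨hr1, hr2⟩
  · rcases le_total 0 r with h0 | h0
    · have hpos : ∀ x ∈ Ω, 0 < x.1 := fun x hx => (hdom x hx).1
      refine ⟨fun x => x.1 ^ r, fun x hx => Real.rpow_nonneg (hpos x hx).le _,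
        continuous_fst.continuousOn.rpow_const fun x hx => Or.inl (hpos x hx).ne', ?_,
        fun _ _ => rfl, 1, one_pos, fun x _ => (one_mul _).ge⟩
      intro x y hseg l hl
      exact (Real.concaveOn_rpow h0 hr2).2 (hpos x (hseg (left_mem_segment ℝ x y))).le
        (hpos y (hseg (right_mem_segment ℝ x y))).le hl.1 (sub_nonneg.2 hl.2) (by ring)
    · have hsm0 : sm < 0 := lt_of_le_of_ne hsm_mem (by rintro rfl; simp_all)
      have hs : 0 < 1 - sm := by linarith
      rw [div_lt_iff_of_neg hsm0] at hr1
      refine exists_bellman_of_tangent hp (inv_pos.2 hs)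
        (Or.inr ⟨inv_le_one_of_one_le₀ (by linarith), h0⟩) ?_ ?_
      · rw [← div_eq_mul_inv, sub_nonneg, div_le_iff₀ hs]
        linarith
      · rwa [rpowTangent_inv_one hp0 hQ0 (by linarith) (by nlinarith) hsm]
  · have hsp0 : 0 < sp := lt_of_le_of_ne hsp_mem.1 (by rintro rfl; simp_all)
    have hps : p * sp ≤ 1 := (le_div_iff₀' hp0).1 hsp_mem.2
    have hs : 0 < 1 - sp := by nlinarith
    rw [lt_div_iff₀ hsp0] at hr2
    refine exists_bellman_of_tangent hp (inv_pos.2 hs)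
      (Or.inl ⟨(one_le_inv₀ hs).2 (by linarith), hr1⟩) ?_ ?_
    · rw [← div_eq_mul_inv, sub_nonneg, div_le_iff₀ hs]
      linarith
    · rwa [rpowTangent_inv_one hp0 hQ0 (by linarith) hps hsp]
end
end
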